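/- Let H be a fixed graph and assume n is even. Then with probability tending to 1 as n → ∞, the hitting time of having a perfect matching in the random motif graph process equals the hitting time of minimum degree one: τ_M = τ_1, where τ_M = min{i : Ḡ_i(H,n) has a perfect matching} and τ_1 = min{i : δ(Ḡ_i(H,n)) ≥ 1}. -/

import Mathlib

open Filter

namespace RandomMotif

/-- `G` is a *copy* of `H` in the complete graph on `Fin n`: the image of `H`
under an injection of its vertices into `Fin n`. -/
def IsCopy {k n : ℕ} (H : SimpleGraph (Fin k)) (G : SimpleGraph (Fin n)) : Prop :=
  ∃ f : Fin k ↪ Fin n, G = H.map f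

/-- The type of copies of `H` in `K_n`. -/
abbrev Copy {k : ℕ} (H : SimpleGraph (Fin k)) (n : ℕ) : Type :=
  {G : SimpleGraph (Fin n) // IsCopy H G}

/-- `N`, the total number of copies of `H` in `K_n`. -/
noncomputable def numCopies {k : ℕ} (H : SimpleGraph (Fin k)) (n : ℕ) : ℕ :=
  Nat.card (Copy H n)

/-- A sample of the random motif graph process: a uniformly random ordering
`H_1, H_2, …, H_N` of all copies of `H` in `K_n`. -/
abbrev ProcSample {k : ℕ} (H : SimpleGraph (Fin k)) (n : ℕ) : Type :=
  Fin (numCopies H n) ≃ Copy H n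

/-- The probability (uniform over all orderings of the copies) of the event `P`
for the random motif graph process. -/
noncomputable def procProb {k : ℕ} (H : SimpleGraph (Fin k)) (n : ℕ)
    (P : ProcSample H n → Prop) : ℝ :=
  (Nat.card {ω : ProcSample H n // P ω} : ℝ) / (Nat.card (ProcSample H n) : ℝ)

/-- `Ḡ_i(H,n)`: the union of the first `i` copies of the process. -/
noncomputable def procGraph {k n : ℕ} {H : SimpleGraph (Fin k)} (ω : ProcSample H n)
    (i : ℕ) : SimpleGraph (Fin n) :=
  ⨆ j : Fin (numCopies H n), if (j : ℕ) < i then (ω j).1 else ⊥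

/-- `τ_d`: the hitting time of minimum degree at least `d`. -/
noncomputable def tauDeg {k n : ℕ} {H : SimpleGraph (Fin k)} (d : ℕ)
    (ω : ProcSample H n) : ℕ :=
  sInf {i : ℕ | ∀ v : Fin n, d ≤ ((procGraph ω i).neighborSet v).ncard}

/-- `τ_M`: the hitting time of having a perfect matching. -/
noncomputable def tauMatch {k n : ℕ} {H : SimpleGraph (Fin k)} (ω : ProcSample H n) : ℕ :=
  sInf {i : ℕ | ∃ M : (procGraph ω i).Subgraph, M.IsPerfectMatching}

section Deterministic
open scoped Classical

/-- The odd components of a Tutte violator, encoded by a labelling of the vertices. -/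
lemma exists_component_labelling {V : Type*} [Fintype V] (G : SimpleGraph V)
    (heven : Even (Fintype.card V)) (hG : ¬ ∃ M : G.Subgraph, M.IsPerfectMatching) :
    ∃ (S : Finset V) (f : V → V),
      (∀ v w, v ∉ S → w ∉ S → G.Adj v w → f v = f w) ∧
      S.card + 2 ≤ (Sᶜ.image f).card := by
  rw [SimpleGraph.tutte] at hG
  push Not at hG
  obtain ⟨u, hu⟩ := hG
  unfold SimpleGraph.IsTutteViolator at hu
  set K := ((⊤ : G.Subgraph).deleteVerts u).coe with hK
  have hverts : ∀ v, v ∈ ((⊤ : G.Subgraph).deleteVerts u).verts ↔ v ∉ u := by simp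
  have hpar := K.odd_ncard_oddComponents
  have hcard : Nat.card ((⊤ : G.Subgraph).deleteVerts u).verts + u.ncard = Fintype.card V := by
    have : ((⊤ : G.Subgraph).deleteVerts u).verts = uᶜ := by ext v; simp
    rw [this, Nat.card_coe_set_eq, add_comm, Set.ncard_add_ncard_compl, Nat.card_eq_fintype_card]
  have hodd : u.ncard + 2 ≤ K.oddComponents.ncard := by
    rw [Nat.even_iff] at heven
    rw [Nat.odd_iff, Nat.odd_iff] at hpar
    omega
  refine ⟨u.toFinset, fun v => if h : v ∈ ((⊤ : G.Subgraph).deleteVerts u).verts then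
    ((K.connectedComponentMk ⟨v, h⟩).out : V) else v, ?_, ?_⟩
  · intro v w hv hw hvw
    rw [Set.mem_toFinset] at hv hw
    have hv' := (hverts v).2 hv
    have hw' := (hverts w).2 hw
    simp only [hv', hw', dif_pos]
    have : K.Adj ⟨v, hv'⟩ ⟨w, hw'⟩ := by
      simp [hK, hv, hw, hvw]
    rw [SimpleGraph.ConnectedComponent.connectedComponentMk_eq_of_adj this]
  · rw [← Set.ncard_eq_toFinset_card']
    refine hodd.trans ?_
    rw [← Set.ncard_coe_finset]
    refine Set.ncard_le_ncard_of_injOn (fun c => (c.out : V)) ?_ ?_ (Finset.finite_toSet _)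
    · intro c _
      simp only [Finset.coe_image, Set.mem_image]
      refine ⟨(c.out : V), ?_, ?_⟩
      · have := c.out.2
        rw [hverts] at this
        simpa using this
      · rw [dif_pos c.out.2]
        have : K.connectedComponentMk ⟨(c.out : V), c.out.2⟩ = c := Quot.out_eq c
        rw [this]
    · intro c _ c' _ h
      have h1 : c.out = c'.out := Subtype.ext h
      rw [← Quot.out_eq c, ← Quot.out_eq c', h1]

/-- If large disjoint sets are always joined by an edge, then the absence of a perfect matching
is witnessed by a small union of components. -/
lemma exists_small_tutte_witness {V : Type*} [Fintype V] (G : SimpleGraph V)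
    (heven : Even (Fintype.card V)) (hG : ¬ ∃ M : G.Subgraph, M.IsPerfectMatching)
    (a : ℕ) (ha : 1 ≤ a) (ha2 : 2 * a ≤ Fintype.card V)
    (hP : ∀ P Q : Finset V, a ≤ P.card → a ≤ Q.card → Disjoint P Q →
      ∃ v ∈ P, ∃ w ∈ Q, G.Adj v w) :
    ∃ (S U : Finset V) (f : V → V), S.card + 1 ≤ (U.image f).card ∧ U.card < 2 * a ∧
      (∀ v ∈ U, v ∉ S) ∧
      ∀ v ∈ U, ∀ w, G.Adj v w → w ∉ S → w ∈ U ∧ f w = f v := by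
  obtain ⟨S, f, hf, hS⟩ := exists_component_labelling G heven hG
  set R := Sᶜ with hR
  set I := R.image f with hI
  let cells : Finset V → Finset V := fun J => R.filter (fun v => f v ∈ J)
  have hRcard : R.card + S.card = Fintype.card V := by
    rw [hR, Finset.card_compl]; have := S.card_le_univ; omega
  have hIR : I.card ≤ R.card := Finset.card_image_le
  obtain ⟨J, hJ, hJmax⟩ := Finset.exists_max_image
    (I.powerset.filter (fun J => (cells J).card < a)) Finset.card
    ⟨∅, by simp [cells]; omega⟩
  rw [Finset.mem_filter, Finset.mem_powerset] at hJ
  have hcI : cells I = R := by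
    ext v
    simp only [cells, Finset.mem_filter, and_iff_left_iff_imp]
    exact fun hv => Finset.mem_image_of_mem f hv
  obtain ⟨i, hiI, hiJ⟩ : ∃ i ∈ I, i ∉ J := by
    by_contra! h
    have : J = I := Finset.Subset.antisymm hJ.1 h
    rw [this, hcI] at hJ
    omega
  have hJ' : a ≤ (cells (insert i J)).card := by
    by_contra! h
    have := hJmax (insert i J) (by
      rw [Finset.mem_filter, Finset.mem_powerset]
      exact ⟨Finset.insert_subset hiI hJ.1, h⟩)
    rw [Finset.card_insert_of_notMem hiJ] at this
    omega
  have hrest : (R \ cells (insert i J)).card < a := by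
    by_contra! h
    obtain ⟨v, hv, w, hw, hvw⟩ := hP _ _ hJ' h Finset.disjoint_sdiff
    simp only [cells, Finset.mem_filter, Finset.mem_sdiff, not_and, hR, Finset.mem_compl] at hv hw
    have := hf v w hv.1 hw.1 hvw
    exact hw.2 hw.1 (this ▸ hv.2)
  refine ⟨S, R.filter (fun v => f v ≠ i), f, ?_, ?_, ?_, ?_⟩
  · have : I.erase i ⊆ (R.filter (fun v => f v ≠ i)).image f := by
      intro j hj
      rw [Finset.mem_erase, hI, Finset.mem_image] at hj
      obtain ⟨hji, v, hv, rfl⟩ := hj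
      exact Finset.mem_image_of_mem f (Finset.mem_filter.2 ⟨hv, hji⟩)
    have := Finset.card_le_card this
    rw [Finset.card_erase_of_mem hiI] at this
    omega
  · have : R.filter (fun v => f v ≠ i) ⊆ cells J ∪ (R \ cells (insert i J)) := by
      intro v hv
      simp only [cells, Finset.mem_filter, Finset.mem_union, Finset.mem_sdiff,
        Finset.mem_insert] at hv ⊢
      tauto
    have := (Finset.card_le_card this).trans (Finset.card_union_le _ _)
    omega
  · intro v hv
    simpa [hR] using (Finset.mem_filter.1 hv).1
  · intro v hv w hvw hw
    rw [Finset.mem_filter, hR, Finset.mem_compl] at hv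
    have := hf v w hv.1 hw hvw
    refine ⟨?_, this.symm⟩
    rw [Finset.mem_filter, hR, Finset.mem_compl]
    exact ⟨hw, this ▸ hv.2⟩

/-- The union of a family of graphs. -/
def unionGraph {C V : Type*} (gr : C → SimpleGraph V) (A : Finset C) : SimpleGraph V :=
  ⨆ c ∈ A, gr c

lemma unionGraph_adj {C V : Type*} {gr : C → SimpleGraph V} {A : Finset C} {v w : V} :
    (unionGraph gr A).Adj v w ↔ ∃ c ∈ A, (gr c).Adj v w := by
  simp [unionGraph, SimpleGraph.iSup_adj]

/-- Deterministic criterion for a perfect matching in a union of small graphs: large sets are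
joined by edges, small sets span few of the graphs, and vertices lying in few of the graphs
(those of `X`) are far apart. -/
theorem exists_isPerfectMatching {C V : Type*} [Fintype V] (gr : C → SimpleGraph V)
    (heven : Even (Fintype.card V)) (A D : Finset C) (hAD : A ⊆ D) (k : ℕ)
    (hk : ∀ c, (Finset.univ.filter (fun v => v ∈ (gr c).support)).card ≤ k)
    (hdeg : ∀ v, ∃ w, (unionGraph gr D).Adj v w)
    (a : ℕ) (ha : 1 ≤ a) (ha2 : 2 * a ≤ Fintype.card V)
    (hjoin : ∀ P Q : Finset V, a ≤ P.card → a ≤ Q.card → Disjoint P Q →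
      ∃ c ∈ A, ∃ v ∈ P, ∃ w ∈ Q, (gr c).Adj v w)
    (θ : ℝ) (hθ : 0 ≤ θ)
    (hsparse : ∀ W : Finset V, W.Nonempty → W.card ≤ 4 * a →
      (4 * k * (A.filter (fun c => ∃ v ∈ W, ∃ w ∈ W, v ≠ w ∧ v ∈ (gr c).support ∧
        w ∈ (gr c).support)).card : ℝ) < θ * W.card)
    (X : Finset V) (hX : ∀ v, v ∉ X → θ ≤ (A.filter (fun c => v ∈ (gr c).support)).card)
    (hfar : ∀ v ∈ X, ∀ w ∈ X, ∀ p : (unionGraph gr D).Walk v w, p.length ≤ 4 → v = w) :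
    ∃ M : (unionGraph gr D).Subgraph, M.IsPerfectMatching := by
  set G := unionGraph gr D with hGdef
  by_contra hG
  obtain ⟨S, U, f, hSU, hUa, hUS, hU⟩ := exists_small_tutte_witness G heven hG a ha ha2 (by
    intro P Q h1 h2 h3
    obtain ⟨c, hc, v, hv, w, hw, h⟩ := hjoin P Q h1 h2 h3
    exact ⟨v, hv, w, hw, unionGraph_adj.2 ⟨c, hAD hc, h⟩⟩)
  choose φ hφ using hdeg
  set Y := U \ X with hY
  set T := U.filter (fun v => v ∈ X ∧ ∀ w, G.Adj v w → w ∈ S) with hT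
  have hcov : (U.image f).card ≤ T.card + Y.card := by
    have hsub : U.image f ⊆ T.image f ∪ Y.image f := by
      intro i hi
      obtain ⟨v, hv, rfl⟩ := Finset.mem_image.1 hi
      rw [Finset.mem_union]
      by_cases hvX : v ∈ X
      · by_cases hn : ∀ w, G.Adj v w → w ∈ S
        · exact Or.inl (Finset.mem_image_of_mem f (by simp [hT, hv, hvX]; exact hn))
        · push Not at hn
          obtain ⟨w, hvw, hw⟩ := hn
          obtain ⟨hwU, hfw⟩ := hU v hv w hvw hw
          refine Or.inr (Finset.mem_image.2 ⟨w, ?_, hfw⟩)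
          rw [hY, Finset.mem_sdiff]
          refine ⟨hwU, fun hwX => hvw.ne ?_⟩
          exact hfar v hvX w hwX (.cons hvw .nil) (by simp)
      · exact Or.inr (Finset.mem_image_of_mem f (by simp [hY, hv, hvX]))
    exact (Finset.card_le_card hsub).trans ((Finset.card_union_le _ _).trans
      (add_le_add Finset.card_image_le Finset.card_image_le))
  have hTX : ∀ x ∈ T, x ∈ X := fun x hx => (Finset.mem_filter.1 hx).2.1
  set S₁ := T.image φ with hS₁
  have hS₁S : S₁ ⊆ S := by
    intro s hs
    obtain ⟨x, hx, rfl⟩ := Finset.mem_image.1 hs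
    exact (Finset.mem_filter.1 hx).2.2 _ (hφ x)
  have hS₁card : S₁.card = T.card := by
    refine Finset.card_image_of_injOn ?_
    intro x hx x' hx' h
    have h' := (hφ x').symm
    rw [← h] at h'
    exact hfar x (hTX x hx) x' (hTX x' hx') (.cons (hφ x) (.cons h' .nil)) (by simp)
  set S' := S \ S₁ with hS'
  have hS'card : S'.card + T.card = S.card := by
    rw [hS', ← hS₁card]; exact Finset.card_sdiff_add_card_eq_card hS₁S
  set N : V → Finset V := fun y => Finset.univ.filter (fun z => G.Adj y z ∧ (z ∈ X ∨ z ∈ S₁))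
    with hN
  have hNcard : ∀ y, (N y).card ≤ 2 := by
    intro y
    have hclose : ∀ z ∈ N y, ∃ x ∈ X, (z = x ∨ z = φ x) ∧
        ∃ p : G.Walk y x, p.length ≤ 2 := by
      intro z hz
      simp only [hN, Finset.mem_filter, Finset.mem_univ, true_and] at hz
      rcases hz with ⟨hyz, hz | hz⟩
      · exact ⟨z, hz, Or.inl rfl, .cons hyz .nil, by simp⟩
      · obtain ⟨x, hx, rfl⟩ := Finset.mem_image.1 hz
        exact ⟨x, hTX x hx, Or.inr rfl, .cons hyz (.cons (hφ x).symm .nil), by simp⟩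
    rcases (N y).eq_empty_or_nonempty with h0 | ⟨z₀, hz₀⟩
    · simp [h0]
    · obtain ⟨x, hxX, -, p, hp⟩ := hclose z₀ hz₀
      have : N y ⊆ {x, φ x} := by
        intro z hz
        obtain ⟨x', hx'X, hz', p', hp'⟩ := hclose z hz
        have := hfar x hxX x' hx'X (p.reverse.append p') (by
          rw [SimpleGraph.Walk.length_append, SimpleGraph.Walk.length_reverse]; omega)
        subst this
        simpa using hz'
      exact (Finset.card_le_card this).trans Finset.card_le_two
  set W := Y ∪ S' ∪ Y.biUnion N with hW
  have hYS : S'.card + 1 ≤ Y.card := by omega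
  have hWcard : W.card ≤ 4 * Y.card := by
    have h1 : (Y.biUnion N).card ≤ Y.card * 2 :=
      Finset.card_biUnion_le_card_mul _ _ _ (fun y _ => hNcard y)
    have h2 : W.card ≤ _ := Finset.card_union_le (Y ∪ S') (Y.biUnion N)
    have h3 := Finset.card_union_le Y S'
    omega
  have hnbr : ∀ y ∈ U, ∀ w, G.Adj y w → w ∈ U ∪ S := by
    intro y hy w hw
    by_cases hwS : w ∈ S
    · exact Finset.mem_union_right _ hwS
    · exact Finset.mem_union_left _ (hU y hy w hw hwS).1
  have hYU : Y ⊆ U := Finset.sdiff_subset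
  have hWsub : W ⊆ U ∪ S := by
    rw [hW]
    refine Finset.union_subset (Finset.union_subset ?_ ?_) ?_
    · exact hYU.trans Finset.subset_union_left
    · exact Finset.sdiff_subset.trans Finset.subset_union_right
    · refine Finset.biUnion_subset.2 fun y hy z hz => ?_
      exact hnbr y (hYU hy) z (Finset.mem_filter.1 hz).2.1
  have hW4a : W.card ≤ 4 * a := by
    have h1 := (Finset.card_le_card hWsub).trans (Finset.card_union_le _ _)
    have h2 : (U.image f).card ≤ U.card := Finset.card_image_le
    omega
  have hYne : Y.Nonempty := Finset.card_pos.1 (by omega)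
  have hWne : W.Nonempty :=
    hYne.mono (Finset.subset_union_left.trans Finset.subset_union_left)
  set A' := A.filter (fun c => ∃ v ∈ W, ∃ w ∈ W, v ≠ w ∧ v ∈ (gr c).support ∧
        w ∈ (gr c).support) with hA'
  have hspan : ∀ y ∈ Y, A.filter (fun c => y ∈ (gr c).support) ⊆
      A'.filter (fun c => y ∈ (gr c).support) := by
    intro y hy c hc
    rw [Finset.mem_filter] at hc
    obtain ⟨z, hz⟩ := hc.2
    have hyz : G.Adj y z := unionGraph_adj.2 ⟨c, hAD hc.1, hz⟩
    have hyW : y ∈ W := Finset.mem_union_left _ (Finset.mem_union_left _ hy)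
    have hzW : z ∈ W := by
      have hzN : z ∈ X ∨ z ∈ S₁ → z ∈ W := fun h =>
        Finset.mem_union_right _ (Finset.mem_biUnion.2 ⟨y, hy, by simp [hN, hyz, h]⟩)
      rcases Finset.mem_union.1 (hnbr y (hYU hy) z hyz) with h | h
      · by_cases hzX : z ∈ X
        · exact hzN (Or.inl hzX)
        · exact Finset.mem_union_left _ (Finset.mem_union_left _ (Finset.mem_sdiff.2 ⟨h, hzX⟩))
      · by_cases hz1 : z ∈ S₁
        · exact hzN (Or.inr hz1)
        · exact Finset.mem_union_left _ (Finset.mem_union_right _ (Finset.mem_sdiff.2 ⟨h, hz1⟩))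
    rw [Finset.mem_filter, hA', Finset.mem_filter]
    exact ⟨⟨hc.1, y, hyW, z, hzW, hz.ne, hc.2, ⟨y, hz.symm⟩⟩, hc.2⟩
  have hcount : θ * Y.card ≤ k * A'.card := by
    have h1 : θ * Y.card ≤ ∑ y ∈ Y, ((A'.filter (fun c => y ∈ (gr c).support)).card : ℝ) := by
      rw [mul_comm, ← nsmul_eq_mul]
      refine Finset.card_nsmul_le_sum _ _ _ fun y hy => ?_
      refine (hX y (Finset.mem_sdiff.1 hy).2).trans ?_
      exact_mod_cast Finset.card_le_card (hspan y hy)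
    refine h1.trans ?_
    have h2 : ∑ y ∈ Y, (A'.filter (fun c => y ∈ (gr c).support)).card =
        ∑ c ∈ A', (Y.filter (fun y => y ∈ (gr c).support)).card :=
      Finset.sum_card_bipartiteAbove_eq_sum_card_bipartiteBelow _
    have h3 : ∑ c ∈ A', (Y.filter (fun y => y ∈ (gr c).support)).card ≤ A'.card * k := by
      rw [← smul_eq_mul]
      refine Finset.sum_le_card_nsmul _ _ _ fun c _ => ?_
      exact (Finset.card_le_card (Finset.filter_subset_filter _ (Finset.subset_univ _))).trans
        (hk c)
    rw [mul_comm (k : ℝ)]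
    exact_mod_cast h2.le.trans h3
  have h1 := hsparse W hWne hW4a
  have h2 : θ * W.card ≤ θ * (4 * Y.card) :=
    mul_le_mul_of_nonneg_left (by exact_mod_cast hWcard) hθ
  linarith

end Deterministic

section Transfer
open scoped Classical

/-- The expectation of `f` over independent labels with common weights `w`. -/
noncomputable def labelExp {C : Type*} [Fintype C] (w : Fin 3 → ℝ) (f : (C → Fin 3) → ℝ) : ℝ :=
  ∑ t, (∏ c, w (t c)) * f t

/-- The probability of `P` under independent labels with common weights `w`. -/
noncomputable def labelProb {C : Type*} [Fintype C] (w : Fin 3 → ℝ)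
    (P : (C → Fin 3) → Prop) : ℝ :=
  labelExp w (fun t => if P t then 1 else 0)

lemma labelExp_prod {C : Type*} [Fintype C] (w : Fin 3 → ℝ) (g : C → Fin 3 → ℝ) :
    labelExp w (fun t => ∏ c, g c (t c)) = ∏ c, ∑ i, w i * g c i := by
  unfold labelExp
  simp_rw [← Finset.prod_mul_distrib]
  rw [Finset.prod_univ_sum, Fintype.piFinset_univ]

lemma labelExp_mono {C : Type*} [Fintype C] {w : Fin 3 → ℝ} (hw : ∀ i, 0 ≤ w i)
    {f g : (C → Fin 3) → ℝ} (h : ∀ t, f t ≤ g t) : labelExp w f ≤ labelExp w g :=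
  Finset.sum_le_sum fun t _ =>
    mul_le_mul_of_nonneg_left (h t) (Finset.prod_nonneg fun _ _ => hw _)

lemma labelExp_add {C : Type*} [Fintype C] (w : Fin 3 → ℝ) (f g : (C → Fin 3) → ℝ) :
    labelExp w (fun t => f t + g t) = labelExp w f + labelExp w g := by
  simp [labelExp, mul_add, Finset.sum_add_distrib]

lemma labelExp_const_mul {C : Type*} [Fintype C] (w : Fin 3 → ℝ) (a : ℝ)
    (f : (C → Fin 3) → ℝ) :
    labelExp w (fun t => a * f t) = a * labelExp w f := by
  simp only [labelExp, Finset.mul_sum]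
  exact Finset.sum_congr rfl fun t _ => by ring

lemma labelExp_sum {C ι : Type*} [Fintype C] (w : Fin 3 → ℝ) (s : Finset ι)
    (f : ι → (C → Fin 3) → ℝ) :
    labelExp w (fun t => ∑ i ∈ s, f i t) = ∑ i ∈ s, labelExp w (f i) := by
  simp only [labelExp, Finset.mul_sum]
  exact Finset.sum_comm

lemma labelExp_one {C : Type*} [Fintype C] {w : Fin 3 → ℝ} (hw1 : ∑ i, w i = 1) :
    labelExp w (fun _ : C → Fin 3 => 1) = 1 := by
  simpa [hw1] using labelExp_prod w (fun (_ : C) _ => (1 : ℝ))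

lemma labelProb_mono {C : Type*} [Fintype C] {w : Fin 3 → ℝ} (hw : ∀ i, 0 ≤ w i)
    {P Q : (C → Fin 3) → Prop} (h : ∀ t, P t → Q t) : labelProb w P ≤ labelProb w Q := by
  refine labelExp_mono hw fun t => ?_
  by_cases hP : P t
  · simp [hP, h t hP]
  · simp only [hP, if_false]; split_ifs <;> norm_num

lemma labelProb_or_le {C : Type*} [Fintype C] {w : Fin 3 → ℝ} (hw : ∀ i, 0 ≤ w i)
    (P Q : (C → Fin 3) → Prop) :
    labelProb w (fun t => P t ∨ Q t) ≤ labelProb w P + labelProb w Q := by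
  unfold labelProb
  rw [← labelExp_add]
  refine labelExp_mono hw fun t => ?_
  by_cases hP : P t <;> by_cases hQ : Q t <;> simp [hP, hQ]

lemma labelProb_exists_le {C ι : Type*} [Fintype C] {w : Fin 3 → ℝ} (hw : ∀ i, 0 ≤ w i)
    (s : Finset ι) (P : ι → (C → Fin 3) → Prop) :
    labelProb w (fun t => ∃ i ∈ s, P i t) ≤ ∑ i ∈ s, labelProb w (P i) := by
  unfold labelProb
  rw [← labelExp_sum]
  refine labelExp_mono hw fun t => ?_
  have hnn : ∀ i ∈ s, (0 : ℝ) ≤ if P i t then 1 else 0 := fun i _ => by split_ifs <;> norm_num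
  split_ifs with h
  · obtain ⟨i, hi, hP⟩ := h
    simpa [hP] using Finset.single_le_sum hnn hi
  · exact Finset.sum_nonneg hnn

/-- A uniformly random ordering, cut at independent binomial-type times, yields independent
labels; hence label events that force `P` bound its probability from below. -/
lemma one_sub_labelProb_le {C : Type*} [Fintype C] {N : ℕ} (hN : Fintype.card C = N)
    {w : Fin 3 → ℝ} (hw : ∀ i, 0 ≤ w i) (hw1 : ∑ i, w i = 1)
    (P : (Fin N ≃ C) → Prop) (bad : (C → Fin 3) → Prop)
    (h : ∀ (ω : Fin N ≃ C) (u : Fin N → Fin 3), Monotone u → ¬ bad (u ∘ ω.symm) → P ω) :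
    1 - labelProb w bad ≤ (Nat.card {ω : Fin N ≃ C // P ω} : ℝ) / Nat.card (Fin N ≃ C) := by
  have hne : Nonempty (Fin N ≃ C) := ⟨(Fintype.equivFinOfCardEq hN).symm⟩
  have hpos : (0 : ℝ) < Fintype.card (Fin N ≃ C) := by exact_mod_cast Fintype.card_pos
  let b : (C → Fin 3) → ℝ := fun t => if bad t then 1 else 0
  have hone : ∑ u : Fin N → Fin 3, ∏ j, w (u j) = 1 := by
    have := labelExp_one (C := Fin N) hw1
    simp only [labelExp, mul_one] at this
    convert this
  have key : (Fintype.card (Fin N ≃ C) : ℝ) * labelProb w bad =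
      ∑ u : Fin N → Fin 3, (∏ j, w (u j)) * ∑ ω : Fin N ≃ C, b ((u ∘ Tuple.sort u) ∘ ω.symm) := by
    have h1 : ∀ ω : Fin N ≃ C, labelProb w bad =
        ∑ u : Fin N → Fin 3, (∏ j, w (u j)) * b (u ∘ ω.symm) := by
      intro ω
      unfold labelProb labelExp
      refine Fintype.sum_equiv (Equiv.arrowCongr ω.symm (Equiv.refl (Fin 3))) _ _ fun t => ?_
      congr 1
      · refine Fintype.prod_equiv ω.symm _ _ fun c => ?_
        simp
      · simp only [b]
        congr! 2
        ext c
        simp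
    calc (Fintype.card (Fin N ≃ C) : ℝ) * labelProb w bad = ∑ _ω : Fin N ≃ C, labelProb w bad := by
          simp
      _ = ∑ ω : Fin N ≃ C, ∑ u : Fin N → Fin 3, (∏ j, w (u j)) * b (u ∘ ω.symm) :=
          Finset.sum_congr rfl fun ω _ => h1 ω
      _ = ∑ u : Fin N → Fin 3, (∏ j, w (u j)) * ∑ ω : Fin N ≃ C, b (u ∘ ω.symm) := by
          rw [Finset.sum_comm]; simp_rw [Finset.mul_sum]
      _ = _ := by
          refine Finset.sum_congr rfl fun u _ => ?_
          congr 1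
          refine (Fintype.sum_equiv (Equiv.equivCongr (Tuple.sort u) (Equiv.refl C)) _ _
            fun ω => ?_).symm
          congr 1
  have hlow : ((Fintype.card (Fin N ≃ C) : ℝ) - Fintype.card {ω : Fin N ≃ C // P ω}) ≤
      (Fintype.card (Fin N ≃ C) : ℝ) * labelProb w bad := by
    rw [key]
    have h2 : ∀ u : Fin N → Fin 3, ((Fintype.card (Fin N ≃ C) : ℝ) - Fintype.card {ω : Fin N ≃ C // P ω}) ≤
        ∑ ω : Fin N ≃ C, b ((u ∘ Tuple.sort u) ∘ ω.symm) := by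
      intro u
      have h3 : (Fintype.card (Fin N ≃ C) : ℝ) - Fintype.card {ω : Fin N ≃ C // P ω} =
          ∑ ω : Fin N ≃ C, if P ω then 0 else 1 := by
        have : ∀ ω : Fin N ≃ C, (if P ω then (0 : ℝ) else 1) = 1 - if P ω then 1 else 0 := by
          intro ω; split_ifs <;> norm_num
        simp_rw [this]
        rw [Finset.sum_sub_distrib, Finset.sum_boole, Fintype.card_subtype]
        simp
      rw [h3]
      refine Finset.sum_le_sum fun ω _ => ?_
      have := h ω (u ∘ Tuple.sort u) (Tuple.monotone_sort u)
      simp only [b]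
      by_cases hb : bad ((u ∘ Tuple.sort u) ∘ ω.symm)
      · rw [if_pos hb]; split_ifs <;> norm_num
      · simp [this hb, hb]
    calc (Fintype.card (Fin N ≃ C) : ℝ) - Fintype.card {ω : Fin N ≃ C // P ω}
        = ∑ u : Fin N → Fin 3, (∏ j, w (u j)) *
          ((Fintype.card (Fin N ≃ C) : ℝ) - Fintype.card {ω : Fin N ≃ C // P ω}) := by
          rw [← Finset.sum_mul, hone, one_mul]
      _ ≤ _ := Finset.sum_le_sum fun u _ =>
          mul_le_mul_of_nonneg_left (h2 u) (Finset.prod_nonneg fun j _ => hw _)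
  rw [Nat.card_eq_fintype_card, Nat.card_eq_fintype_card, le_div_iff₀ hpos]
  linarith

lemma procGraph_eq_unionGraph {k n : ℕ} {H : SimpleGraph (Fin k)} [Fintype (Copy H n)]
    (ω : ProcSample H n) (i : ℕ) :
    procGraph ω i = unionGraph (fun c : Copy H n => c.1)
      (Finset.univ.filter (fun c => (ω.symm c : ℕ) < i)) := by
  ext v w
  rw [unionGraph_adj]
  simp only [procGraph, SimpleGraph.iSup_adj, Finset.mem_filter, Finset.mem_univ, true_and]
  constructor
  · rintro ⟨j, hj⟩
    split_ifs at hj with h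
    · exact ⟨ω j, by simpa using h, hj⟩
    · simp at hj
  · rintro ⟨c, hc, hvw⟩
    exact ⟨ω.symm c, by simpa [hc] using hvw⟩

lemma tauMatch_eq_tauDeg_one {k n : ℕ} {H : SimpleGraph (Fin k)} [Fintype (Copy H n)]
    (ω : ProcSample H n) (u : Fin (numCopies H n) → Fin 3) (hu : Monotone u)
    (hA : ¬ ∀ v, ∃ w, (unionGraph (fun c : Copy H n => c.1)
      (Finset.univ.filter (fun c => u (ω.symm c) = 0))).Adj v w)
    (hD : ∀ v, ∃ w, (unionGraph (fun c : Copy H n => c.1)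
      (Finset.univ.filter (fun c => u (ω.symm c) ≤ 1))).Adj v w)
    (hM : ∀ E : Finset (Copy H n), Finset.univ.filter (fun c => u (ω.symm c) = 0) ⊆ E →
      E ⊆ Finset.univ.filter (fun c => u (ω.symm c) ≤ 1) →
      (∀ v, ∃ w, (unionGraph (fun c : Copy H n => c.1) E).Adj v w) →
      ∃ M : (unionGraph (fun c : Copy H n => c.1) E).Subgraph, M.IsPerfectMatching) :
    tauMatch ω = tauDeg 1 ω := by
  have hdeg : ∀ i, (∀ v : Fin n, 1 ≤ ((procGraph ω i).neighborSet v).ncard) ↔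
      ∀ v, ∃ w, (procGraph ω i).Adj v w := by
    intro i
    refine forall_congr' fun v => ?_
    rw [Nat.succ_le_iff, Set.ncard_pos (Set.toFinite _)]
    rfl
  have hmono : ∀ E F : Finset (Copy H n), E ⊆ F →
      (∀ v, ∃ w, (unionGraph (fun c : Copy H n => c.1) E).Adj v w) →
      ∀ v, ∃ w, (unionGraph (fun c : Copy H n => c.1) F).Adj v w := by
    intro E F hEF h v
    obtain ⟨w, hw⟩ := h v
    obtain ⟨c, hc, hvw⟩ := unionGraph_adj.1 hw
    exact ⟨w, unionGraph_adj.2 ⟨c, hEF hc, hvw⟩⟩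
  have hne : {i : ℕ | ∀ v : Fin n, 1 ≤ ((procGraph ω i).neighborSet v).ncard}.Nonempty := by
    refine ⟨numCopies H n, ?_⟩
    rw [Set.mem_ofPred_eq, hdeg, procGraph_eq_unionGraph]
    refine hmono _ _ (fun c _ => ?_) hD
    simp
  have hT := Nat.sInf_mem hne
  have hTmin : ∀ i, (∀ v, ∃ w, (procGraph ω i).Adj v w) → tauDeg 1 ω ≤ i := fun i hi =>
    Nat.sInf_le ((hdeg i).2 hi)
  change ∀ v : Fin n, 1 ≤ ((procGraph ω (tauDeg 1 ω)).neighborSet v).ncard at hT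
  rw [hdeg] at hT
  have hT' := hT
  set T := tauDeg 1 ω with hTdef
  rw [procGraph_eq_unionGraph] at hT'
  have hpm : ∃ M : (procGraph ω T).Subgraph, M.IsPerfectMatching := by
    rw [procGraph_eq_unionGraph]
    refine hM _ ?_ ?_ hT'
    · intro c hc
      simp only [Finset.mem_filter, Finset.mem_univ, true_and] at hc ⊢
      by_contra! hlt
      refine hA (hmono _ _ (fun c' hc' => ?_) hT')
      simp only [Finset.mem_filter, Finset.mem_univ, true_and] at hc' ⊢
      have : u (ω.symm c') ≤ u (ω.symm c) := hu (Fin.le_def.2 (by omega))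
      rw [hc] at this
      exact Fin.le_zero_iff.1 this
    · intro c hc
      simp only [Finset.mem_filter, Finset.mem_univ, true_and] at hc ⊢
      by_contra! hlt
      have : T ≤ (ω.symm c : ℕ) := by
        refine hTmin _ ?_
        rw [procGraph_eq_unionGraph]
        refine hmono _ _ (fun c' hc' => ?_) hD
        simp only [Finset.mem_filter, Finset.mem_univ, true_and] at hc' ⊢
        by_contra! hle
        have : u (ω.symm c) ≤ u (ω.symm c') := hu (Fin.le_def.2 hle)
        exact absurd (hlt.trans_le (this.trans hc')) (lt_irrefl _)
      omega
  refine le_antisymm (Nat.sInf_le hpm) ?_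
  have hmem : tauMatch ω ∈ {i : ℕ | ∃ M : (procGraph ω i).Subgraph, M.IsPerfectMatching} :=
    Nat.sInf_mem ⟨T, hpm⟩
  obtain ⟨M, hM'⟩ := hmem
  refine hTmin _ fun v => ?_
  obtain ⟨w, hw, -⟩ := hM'.1 (hM'.2 v)
  exact ⟨w, hw.adj_sub⟩

end Transfer

section Exploration
open scoped Classical

/-- The non-isolated vertices of `gr c`. -/
noncomputable def suppF {C V : Type*} [Fintype V] (gr : C → SimpleGraph V) (c : C) : Finset V :=
  Finset.univ.filter (fun v => v ∈ (gr c).support)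

/-- The members of the family that cover `v`. -/
noncomputable def through {C V : Type*} [Fintype C] (gr : C → SimpleGraph V) (v : V) :
    Finset C :=
  Finset.univ.filter (fun c => v ∈ (gr c).support)

/-- The vertices reached from `v` by the members of `K`. -/
noncomputable def cluster {C V : Type*} [Fintype V] (gr : C → SimpleGraph V) (v : V)
    (K : Finset C) : Finset V :=
  insert v (K.biUnion (suppF gr))

/-- The sets of `i` members of the family that can be explored one after another from `v`. -/
noncomputable def explored {C V : Type*} [Fintype C] [Fintype V] (gr : C → SimpleGraph V)
    (v : V) : ℕ → Finset (Finset C)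
  | 0 => {∅}
  | i + 1 => (explored gr v i).biUnion fun K =>
      (((cluster gr v K).biUnion (through gr)) \ K).image (fun c => insert c K)

lemma mem_suppF {C V : Type*} [Fintype V] {gr : C → SimpleGraph V} {c : C} {v : V} :
    v ∈ suppF gr c ↔ v ∈ (gr c).support := by simp [suppF]

lemma mem_through {C V : Type*} [Fintype C] {gr : C → SimpleGraph V} {c : C} {v : V} :
    c ∈ through gr v ↔ v ∈ (gr c).support := by simp [through]

lemma card_of_mem_explored {C V : Type*} [Fintype C] [Fintype V] {gr : C → SimpleGraph V}
    {v : V} {i : ℕ} {K : Finset C} (hK : K ∈ explored gr v i) : K.card = i := by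
  induction i generalizing K with
  | zero => simp [explored] at hK; simp [hK]
  | succ i ih =>
    simp only [explored, Finset.mem_biUnion, Finset.mem_image, Finset.mem_sdiff] at hK
    obtain ⟨K', hK', c, ⟨-, hc⟩, rfl⟩ := hK
    rw [Finset.card_insert_of_notMem hc, ih hK']

lemma card_cluster_le {C V : Type*} [Fintype V] {gr : C → SimpleGraph V} {k : ℕ}
    (hk : ∀ c, (suppF gr c).card ≤ k) (v : V) (K : Finset C) :
    (cluster gr v K).card ≤ K.card * k + 1 :=
  (Finset.card_insert_le _ _).trans
    (Nat.succ_le_succ (Finset.card_biUnion_le_card_mul _ _ _ fun c _ => hk c))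

lemma card_explored_le {C V : Type*} [Fintype C] [Fintype V] {gr : C → SimpleGraph V}
    {k d : ℕ} (hk : ∀ c, (suppF gr c).card ≤ k) (hd : ∀ v, (through gr v).card ≤ d)
    (v : V) (i m : ℕ) (him : i ≤ m) :
    (explored gr v i).card ≤ ((m * k + 1) * d) ^ i := by
  induction i with
  | zero => simp [explored]
  | succ i ih =>
    rw [pow_succ]
    refine (Finset.card_biUnion_le_card_mul _ _ ((m * k + 1) * d) fun K hK => ?_).trans
      (Nat.mul_le_mul_right _ (ih (by omega)))
    refine Finset.card_image_le.trans ((Finset.card_le_card Finset.sdiff_subset).trans ?_)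
    refine (Finset.card_biUnion_le_card_mul _ _ d fun x _ => hd x).trans ?_
    refine Nat.mul_le_mul_right _ ((card_cluster_le hk v K).trans ?_)
    rw [card_of_mem_explored hK]
    exact Nat.succ_le_succ (Nat.mul_le_mul_right _ (by omega))

lemma exists_mem_explored {C V : Type*} [Fintype C] [Fintype V] {gr : C → SimpleGraph V}
    {E : Finset C} {w v : V} (p : (unionGraph gr E).Walk w v) :
    ∃ j ≤ p.length, ∃ K ∈ explored gr v j, K ⊆ E ∧ w ∈ cluster gr v K := by
  induction p with
  | nil => exact ⟨0, le_rfl, ∅, by simp [explored], by simp, by simp [cluster]⟩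
  | @cons w u v h p ih =>
    obtain ⟨j, hj, K, hK, hKE, hu⟩ := ih
    obtain ⟨c, hc, hwu⟩ := unionGraph_adj.1 h
    have hsupp : w ∈ suppF gr c := mem_suppF.2 ⟨u, hwu⟩
    rw [SimpleGraph.Walk.length_cons]
    by_cases hcK : c ∈ K
    · exact ⟨j, by omega, K, hK, hKE,
        Finset.mem_insert_of_mem (Finset.mem_biUnion.2 ⟨c, hcK, hsupp⟩)⟩
    · refine ⟨j + 1, by omega, insert c K, ?_, Finset.insert_subset hc hKE,
        Finset.mem_insert_of_mem
          (Finset.mem_biUnion.2 ⟨c, Finset.mem_insert_self _ _, hsupp⟩)⟩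
      simp only [explored, Finset.mem_biUnion, Finset.mem_image, Finset.mem_sdiff]
      exact ⟨K, hK, c, ⟨⟨u, hu, mem_through.2 ⟨w, hwu.symm⟩⟩, hcK⟩, rfl⟩

end Exploration

section Probability
open scoped Classical

/-- Weights for being early (with probability `p`), intermediate, or late
(with probability `1 - q`). -/
def phaseWeight (p q : ℝ) : Fin 3 → ℝ := ![p, q - p, 1 - q]

lemma phaseWeight_nonneg {p q : ℝ} (hp : 0 ≤ p) (hpq : p ≤ q) (hq : q ≤ 1) (i : Fin 3) :
    0 ≤ phaseWeight p q i := by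
  fin_cases i <;> simp [phaseWeight] <;> linarith

lemma sum_phaseWeight (p q : ℝ) : ∑ i, phaseWeight p q i = 1 := by
  simp [phaseWeight, Fin.sum_univ_three]

lemma labelExp_phase {C : Type*} [Fintype C] (p q b : ℝ) (K S : Finset C)
    (hKS : Disjoint K S) :
    labelExp (phaseWeight p q) (fun t : C → Fin 3 =>
      (∏ c ∈ K, if t c ≤ 1 then 1 else 0) * ∏ c ∈ S, if t c = 0 then b else 1) =
    q ^ K.card * (1 + (b - 1) * p) ^ S.card := by
  refine Eq.trans ?_ ((labelExp_prod (phaseWeight p q) (fun c i =>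
    (if c ∈ K then (if i ≤ 1 then (1 : ℝ) else 0) else 1) *
      (if c ∈ S then (if i = 0 then b else 1) else 1))).trans ?_)
  · congr 1
    ext t
    rw [Finset.prod_mul_distrib, Fintype.prod_ite_mem, Fintype.prod_ite_mem]
  have h2 : ∀ c, (∑ i, phaseWeight p q i *
      ((if c ∈ K then (if i ≤ 1 then (1 : ℝ) else 0) else 1) *
        (if c ∈ S then (if i = 0 then b else 1) else 1))) =
      (if c ∈ K then q else 1) * (if c ∈ S then 1 + (b - 1) * p else 1) := by
    intro c
    have hne : c ∈ K → c ∉ S := fun h => Finset.disjoint_left.1 hKS h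
    have h21 : ¬ ((2 : Fin 3) ≤ 1) := by decide
    by_cases hK : c ∈ K <;> by_cases hS : c ∈ S <;>
      simp [phaseWeight, Fin.sum_univ_three, hK, hS, h21] <;> first | exact (hne hK hS).elim | ring
  rw [Finset.prod_congr rfl fun c _ => h2 c, Finset.prod_mul_distrib, Fintype.prod_ite_mem,
    Fintype.prod_ite_mem]
  simp

lemma labelProb_no_early {C : Type*} [Fintype C] (p q : ℝ) (S : Finset C) :
    labelProb (phaseWeight p q) (fun t : C → Fin 3 => ∀ c ∈ S, t c ≠ 0) = (1 - p) ^ S.card := by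
  have := labelExp_phase p q 0 ∅ S (by simp)
  simp only [Finset.prod_empty, one_mul, Finset.card_empty, pow_zero, zero_sub, neg_mul] at this
  rw [← sub_eq_add_neg] at this
  rw [← this, labelProb]
  congr 1
  ext t
  split_ifs with h
  · exact (Finset.prod_eq_one fun c hc => by simp [h c hc]).symm
  · push Not at h
    obtain ⟨c, hc, h0⟩ := h
    exact (Finset.prod_eq_zero hc (by simp [h0])).symm

lemma labelProb_all_late {C : Type*} [Fintype C] (p q : ℝ) (S : Finset C) :
    labelProb (phaseWeight p q) (fun t : C → Fin 3 => ∀ c ∈ S, ¬ t c ≤ 1) =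
      (1 - q) ^ S.card := by
  refine Eq.trans ?_ ((labelExp_prod (phaseWeight p q) (fun c i =>
    if c ∈ S then (if i ≤ 1 then (0 : ℝ) else 1) else 1)).trans ?_)
  · unfold labelProb
    congr 1
    ext t
    rw [Fintype.prod_ite_mem]
    split_ifs with h
    · exact (Finset.prod_eq_one fun c hc => by simp [h c hc]).symm
    · push Not at h
      obtain ⟨c, hc, h0⟩ := h
      exact (Finset.prod_eq_zero hc (by simp [h0])).symm
  have h2 : ∀ c, (∑ i, phaseWeight p q i *
      (if c ∈ S then (if i ≤ 1 then (0 : ℝ) else 1) else 1)) = if c ∈ S then 1 - q else 1 := by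
    intro c
    have h21 : ¬ ((2 : Fin 3) ≤ 1) := by decide
    by_cases hS : c ∈ S <;> simp [phaseWeight, Fin.sum_univ_three, hS, h21]
  rw [Finset.prod_congr rfl fun c _ => h2 c, Fintype.prod_ite_mem]
  simp

lemma one_add_pow_le_exp {x : ℝ} (hx : -1 ≤ x) (m : ℕ) : (1 + x) ^ m ≤ Real.exp (x * m) := by
  rw [mul_comm, Real.exp_nat_mul]
  exact pow_le_pow_left₀ (by linarith) (by linarith [Real.add_one_le_exp x]) m

lemma exp_early_count {C : Type*} (s : ℝ) (S : Finset C) (t : C → Fin 3) :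
    (∏ c ∈ S, if t c = 0 then Real.exp s else 1) =
      Real.exp (s * (S.filter (fun c => t c = 0)).card) := by
  rw [Finset.prod_ite, Finset.prod_const_one, mul_one, Finset.prod_const, mul_comm,
    Real.exp_nat_mul]

/-- Exponential moment bound: the members of `K` are not late, and few members of `S` are
early. -/
lemma labelProb_few_early_le {C : Type*} [Fintype C] {p q : ℝ} (hp : 0 ≤ p) (hpq : p ≤ q)
    (hq : q ≤ 1) (K S : Finset C) (hKS : Disjoint K S) (x s : ℝ) (hs : 0 ≤ s) :
    labelProb (phaseWeight p q) (fun t : C → Fin 3 => (∀ c ∈ K, t c ≤ 1) ∧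
      ((S.filter (fun c => t c = 0)).card : ℝ) ≤ x) ≤
    q ^ K.card * Real.exp (s * x - (1 - Real.exp (-s)) * p * S.card) := by
  have hw := phaseWeight_nonneg hp hpq hq
  have h1 := labelExp_phase p q (Real.exp (-s)) K S hKS
  have h2 : labelProb (phaseWeight p q) (fun t : C → Fin 3 => (∀ c ∈ K, t c ≤ 1) ∧
      ((S.filter (fun c => t c = 0)).card : ℝ) ≤ x) ≤
      labelExp (phaseWeight p q) (fun t : C → Fin 3 => Real.exp (s * x) *
      ((∏ c ∈ K, if t c ≤ 1 then 1 else 0) * ∏ c ∈ S, if t c = 0 then Real.exp (-s) else 1)) := by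
    refine labelExp_mono hw fun t => ?_
    split_ifs with h
    · rw [Finset.prod_eq_one fun c hc => if_pos (h.1 c hc), one_mul, exp_early_count,
        ← Real.exp_add]
      refine Real.one_le_exp ?_
      nlinarith [mul_le_mul_of_nonneg_left h.2 hs]
    · exact mul_nonneg (Real.exp_nonneg _) (mul_nonneg
        (Finset.prod_nonneg fun c _ => by split_ifs <;> norm_num)
        (Finset.prod_nonneg fun c _ => by split_ifs <;> positivity))
  refine h2.trans ?_
  rw [labelExp_const_mul, h1, sub_eq_add_neg (s * x), Real.exp_add]
  have h3 : (1 + (Real.exp (-s) - 1) * p) ^ S.card ≤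
      Real.exp ((Real.exp (-s) - 1) * p * S.card) := by
    refine one_add_pow_le_exp ?_ _
    nlinarith [Real.exp_pos (-s)]
  have h4 : (Real.exp (-s) - 1) * p * S.card = -((1 - Real.exp (-s)) * p * S.card) := by ring
  rw [h4] at h3
  calc _ = q ^ K.card * (Real.exp (s * x) * (1 + (Real.exp (-s) - 1) * p) ^ S.card) := by ring
    _ ≤ _ := by
      refine mul_le_mul_of_nonneg_left ?_ (pow_nonneg (hp.trans hpq) _)
      exact mul_le_mul_of_nonneg_left h3 (Real.exp_nonneg _)

/-- Exponential moment bound: many members of `S` are early. -/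
lemma labelProb_many_early_le {C : Type*} [Fintype C] {p q : ℝ} (hp : 0 ≤ p) (hpq : p ≤ q)
    (hq : q ≤ 1) (S : Finset C) (x s : ℝ) (hs : 0 ≤ s) :
    labelProb (phaseWeight p q) (fun t : C → Fin 3 =>
      x ≤ ((S.filter (fun c => t c = 0)).card : ℝ)) ≤
    Real.exp (Real.exp s * p * S.card - s * x) := by
  have hw := phaseWeight_nonneg hp hpq hq
  have h1 := labelExp_phase p q (Real.exp s) ∅ S (by simp)
  simp only [Finset.prod_empty, one_mul, Finset.card_empty, pow_zero] at h1
  have h2 : labelProb (phaseWeight p q) (fun t : C → Fin 3 =>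
      x ≤ ((S.filter (fun c => t c = 0)).card : ℝ)) ≤
      labelExp (phaseWeight p q) (fun t : C → Fin 3 => Real.exp (-(s * x)) *
      ∏ c ∈ S, if t c = 0 then Real.exp s else 1) := by
    refine labelExp_mono hw fun t => ?_
    rw [exp_early_count, ← Real.exp_add]
    split_ifs with h
    · refine Real.one_le_exp ?_
      nlinarith [mul_le_mul_of_nonneg_left h hs]
    · positivity
  refine h2.trans ?_
  rw [labelExp_const_mul, h1, sub_eq_add_neg _ (s * x), Real.exp_add, mul_comm]
  refine mul_le_mul_of_nonneg_right ?_ (Real.exp_nonneg _)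
  refine (one_add_pow_le_exp ?_ _).trans (Real.exp_le_exp.2 ?_)
  · nlinarith [mul_nonneg (Real.exp_pos s).le hp]
  · refine mul_le_mul_of_nonneg_right ?_ (Nat.cast_nonneg _)
    nlinarith

end Probability

section Events
open scoped Classical

/-- A family of graphs of bounded size on `Fin n` covering vertices and pairs of vertices
evenly. -/
structure IsRegularSystem {C : Type*} [Fintype C] {n : ℕ} (gr : C → SimpleGraph (Fin n))
    (k d : ℕ) : Prop where
  card_suppF_le : ∀ c, (suppF gr c).card ≤ k
  card_through : ∀ v, (through gr v).card = d
  card_through_inter : ∀ v w, v ≠ w → (through gr v ∩ through gr w).card * n ≤ 2 * k * d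
  le_card_adj : ∀ v w, v ≠ w →
    d ≤ k * n * (Finset.univ.filter (fun c => (gr c).Adj v w)).card

variable {C : Type*} [Fintype C] {n : ℕ} {gr : C → SimpleGraph (Fin n)} {k d : ℕ}

lemma IsRegularSystem.codeg_le (h : IsRegularSystem gr k d) (hn : 0 < n) {v w : Fin n}
    (hvw : v ≠ w) : ((through gr v ∩ through gr w).card : ℝ) ≤ 2 * k * d / n := by
  rw [le_div_iff₀ (by exact_mod_cast hn)]
  exact_mod_cast h.card_through_inter v w hvw

lemma IsRegularSystem.card_union_add (h : IsRegularSystem gr k d) (v w : Fin n) :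
    ((through gr v ∪ through gr w).card : ℝ) + (through gr v ∩ through gr w).card = 2 * d := by
  have := Finset.card_union_add_card_inter (through gr v) (through gr w)
  rw [h.card_through, h.card_through] at this
  rw [two_mul]
  exact_mod_cast this

/-- The members that are early. -/
noncomputable def early (t : C → Fin 3) : Finset C := Finset.univ.filter (fun c => t c = 0)

/-- The members that are not late. -/
noncomputable def notLate (t : C → Fin 3) : Finset C := Finset.univ.filter (fun c => t c ≤ 1)

lemma IsRegularSystem.labelProb_isolated_le (h : IsRegularSystem gr k d) {p q : ℝ}
    (hp : 0 ≤ p) (hpq : p ≤ q) (hq : q ≤ 1) :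
    labelProb (phaseWeight p q) (fun t => ∃ v ∈ Finset.univ, ∀ c ∈ through gr v, ¬ t c ≤ 1) ≤
      n * Real.exp (-(q * d)) := by
  refine (labelProb_exists_le (phaseWeight_nonneg hp hpq hq) _ _).trans ?_
  simp_rw [labelProb_all_late, h.card_through]
  simp only [Finset.sum_const, Finset.card_univ, Fintype.card_fin, nsmul_eq_mul]
  refine mul_le_mul_of_nonneg_left ?_ (Nat.cast_nonneg _)
  have := one_add_pow_le_exp (x := -q) (by linarith) d
  rwa [neg_mul] at this

lemma exp_le_one_sub {p : ℝ} (hp : 0 ≤ p) (hp' : p ≤ 1 / 20) :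
    Real.exp (-(20 / 19 * p)) ≤ 1 - p := by
  have hpos : 0 < 1 - p := by linarith
  rw [← Real.le_log_iff_exp_le hpos]
  refine le_trans ?_ (Real.one_sub_inv_le_log_of_pos hpos)
  have h1 : (1 - p)⁻¹ ≤ 1 + 20 / 19 * p := by
    rw [inv_le_iff_one_le_mul₀ hpos]
    nlinarith
  linarith

/-- Second moment bound: some vertex is still isolated at the early stage. -/
lemma IsRegularSystem.labelProb_covered_le (h : IsRegularSystem gr k d) {p q : ℝ}
    (hp : 0 ≤ p) (hpq : p ≤ q) (hq : q ≤ 1) (hp' : p ≤ 1 / 20) (hn : 0 < n) :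
    labelProb (phaseWeight p q) (fun t => ∀ v, ¬ ∀ c ∈ through gr v, t c ≠ 0) ≤
      Real.exp (20 / 19 * (p * d)) / n + (Real.exp (4 * k * (p * d) / n) - 1) := by
  have hn' : (0 : ℝ) < n := by exact_mod_cast hn
  set W := phaseWeight p q with hW
  have hw := phaseWeight_nonneg hp hpq hq
  set μ : ℝ := (1 - p) ^ d with hμ
  set e : ℝ := Real.exp (4 * k * (p * d) / n) with he
  have h1p : 0 < 1 - p := by linarith
  have hμpos : 0 < μ := pow_pos h1p d
  let Z : Fin n → (C → Fin 3) → ℝ := fun v t => if ∀ c ∈ through gr v, t c ≠ 0 then 1 else 0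
  have hZ : ∀ v, labelExp W (Z v) = μ := fun v => by
    have := labelProb_no_early p q (through gr v)
    rw [h.card_through] at this
    refine Eq.trans ?_ this
    unfold labelProb
    congr 1
    ext t
    simp only [Z]
    split_ifs <;> rfl
  have hZZ : ∀ v w, labelExp W (fun t => Z v t * Z w t) =
      (1 - p) ^ (through gr v ∪ through gr w).card := fun v w => by
    rw [← labelProb_no_early p q]
    unfold labelProb
    congr 1
    ext t
    have hiff : (∀ c ∈ through gr v ∪ through gr w, t c ≠ 0) ↔
        (∀ c ∈ through gr v, t c ≠ 0) ∧ ∀ c ∈ through gr w, t c ≠ 0 := by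
      simp only [Finset.mem_union, or_imp, forall_and]
    simp only [Z]
    split_ifs with hv hw hvw hvw hw hvw hvw
    · exact mul_one 1
    · exact absurd (hiff.2 ⟨hv, hw⟩) hvw
    · exact absurd (hiff.1 hvw).2 hw
    · exact mul_zero 1
    · exact absurd (hiff.1 hvw).1 hv
    · exact zero_mul 1
    · exact absurd (hiff.1 hvw).1 hv
    · exact zero_mul 0
  have hZZle : ∀ v w, labelExp W (fun t => Z v t * Z w t) ≤ (if v = w then μ else 0) + μ ^ 2 * e := by
    intro v w
    rw [hZZ]
    have he1 : 0 ≤ μ ^ 2 * e := by positivity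
    by_cases hvw : v = w
    · subst hvw
      simp only [Finset.union_self, h.card_through, if_true]
      linarith
    · simp only [hvw, if_false, zero_add]
      set m := (through gr v ∩ through gr w).card
      have hum : (through gr v ∪ through gr w).card + m = d + d := by
        have := Finset.card_union_add_card_inter (through gr v) (through gr w)
        rwa [h.card_through, h.card_through] at this
      have hm := h.codeg_le hn hvw
      have h1 : 1 ≤ (1 - p) ^ m * e := by
        have h2 : Real.exp (-(20 / 19 * p) * m) ≤ (1 - p) ^ m := by
          rw [mul_comm, Real.exp_nat_mul]
          exact pow_le_pow_left₀ (Real.exp_nonneg _) (exp_le_one_sub hp hp') m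
        calc (1 : ℝ) ≤ Real.exp (-(20 / 19 * p) * m) * e := by
              rw [he, ← Real.exp_add]
              refine Real.one_le_exp ?_
              have h3 : p * m ≤ p * (2 * k * d / n) := mul_le_mul_of_nonneg_left hm hp
              have h4 : 4 * k * (p * d) / n = 2 * (p * (2 * k * d / n)) := by ring
              have h5 : 0 ≤ p * m := by positivity
              rw [h4]
              linarith
          _ ≤ _ := mul_le_mul_of_nonneg_right h2 (Real.exp_nonneg _)
      calc (1 - p) ^ (through gr v ∪ through gr w).card
          ≤ (1 - p) ^ (through gr v ∪ through gr w).card * ((1 - p) ^ m * e) :=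
            le_mul_of_one_le_right (pow_nonneg h1p.le _) h1
        _ = μ ^ 2 * e := by
            rw [← mul_assoc, ← pow_add, hum, pow_add, hμ]; ring
  have hvar : labelExp W (fun t => (∑ v, Z v t - n * μ) ^ 2) ≤ n * μ + (n * μ) ^ 2 * (e - 1) := by
    have h1 : ∀ t, (∑ v, Z v t - n * μ) ^ 2 =
        ∑ v, ∑ w, Z v t * Z w t + ((-(2 * n * μ)) * ∑ v, Z v t + (n * μ) ^ 2 * 1) := by
      intro t
      rw [← Finset.sum_mul_sum]
      ring
    simp_rw [h1]
    rw [labelExp_add, labelExp_add, labelExp_const_mul, labelExp_const_mul,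
      labelExp_one (sum_phaseWeight p q), labelExp_sum, labelExp_sum]
    simp_rw [labelExp_sum]
    have h2 : ∑ v : Fin n, ∑ w : Fin n, labelExp W (fun t => Z v t * Z w t) ≤
        ∑ v : Fin n, ∑ w : Fin n, ((if v = w then μ else 0) + μ ^ 2 * e) :=
      Finset.sum_le_sum fun v _ => Finset.sum_le_sum fun w _ => hZZle v w
    simp only [Finset.sum_add_distrib, Finset.sum_ite_eq, Finset.mem_univ, if_true,
      Finset.sum_const, Finset.card_univ, Fintype.card_fin, nsmul_eq_mul] at h2
    have h3 : ∑ v : Fin n, labelExp W (Z v) = n * μ := by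
      simp [hZ]
    rw [h3]
    nlinarith [h2]
  have hmarkov : (n * μ) ^ 2 * labelProb W (fun t => ∀ v, ¬ ∀ c ∈ through gr v, t c ≠ 0) ≤
      labelExp W (fun t => (∑ v, Z v t - n * μ) ^ 2) := by
    unfold labelProb
    rw [← labelExp_const_mul]
    refine labelExp_mono hw fun t => ?_
    split_ifs with ht
    · have : ∑ v, Z v t = 0 := Finset.sum_eq_zero fun v _ => by simp only [Z]; rw [if_neg (ht v)]
      rw [this]
      nlinarith
    · simpa using sq_nonneg _
  have hnμ : 0 < n * μ := mul_pos hn' hμpos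
  have hfin : labelProb W (fun t => ∀ v, ¬ ∀ c ∈ through gr v, t c ≠ 0) ≤
      1 / (n * μ) + (e - 1) := by
    have h2 := hmarkov.trans hvar
    rw [← sub_le_iff_le_add, le_div_iff₀ hnμ]
    refine le_of_mul_le_mul_left ?_ hnμ
    nlinarith [h2]
  refine hfin.trans (add_le_add ?_ le_rfl)
  have hμlow : Real.exp (-(20 / 19 * (p * d))) ≤ μ := by
    have : -(20 / 19 * (p * d)) = d * (-(20 / 19 * p)) := by ring
    rw [this, Real.exp_nat_mul]
    exact pow_le_pow_left₀ (Real.exp_nonneg _) (exp_le_one_sub hp hp') d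
  rw [div_le_div_iff₀ hnμ hn', one_mul]
  have h6 : 1 ≤ Real.exp (20 / 19 * (p * d)) * μ := by
    calc (1 : ℝ) = Real.exp (20 / 19 * (p * d)) * Real.exp (-(20 / 19 * (p * d))) := by
          rw [← Real.exp_add]; simp
      _ ≤ _ := mul_le_mul_of_nonneg_left hμlow (Real.exp_nonneg _)
  nlinarith

/-- Large disjoint sets are joined by an early member. -/
lemma IsRegularSystem.labelProb_not_joined_le (h : IsRegularSystem gr k d) {p q : ℝ}
    (hp : 0 ≤ p) (hpq : p ≤ q) (hq : q ≤ 1) (hn : 0 < n) (hk : 0 < k) (a : ℕ) :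
    labelProb (phaseWeight p q) (fun t => ∃ PQ ∈ (Finset.univ ×ˢ Finset.univ :
        Finset (Finset (Fin n) × Finset (Fin n))).filter
          (fun PQ => a ≤ PQ.1.card ∧ a ≤ PQ.2.card ∧ Disjoint PQ.1 PQ.2),
        ∀ c ∈ Finset.univ.filter (fun c => ∃ v ∈ PQ.1, ∃ w ∈ PQ.2, (gr c).Adj v w), t c ≠ 0) ≤
      4 ^ n * Real.exp (-((p * d) * a ^ 2 / (k ^ 3 * n))) := by
  refine (labelProb_exists_le (phaseWeight_nonneg hp hpq hq) _ _).trans ?_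
  have hn' : (0 : ℝ) < n := by exact_mod_cast hn
  have hk' : (0 : ℝ) < k := by exact_mod_cast hk
  have hbound : ∀ PQ ∈ (Finset.univ ×ˢ Finset.univ :
        Finset (Finset (Fin n) × Finset (Fin n))).filter
          (fun PQ => a ≤ PQ.1.card ∧ a ≤ PQ.2.card ∧ Disjoint PQ.1 PQ.2),
      labelProb (phaseWeight p q) (fun t : C → Fin 3 => ∀ c ∈ Finset.univ.filter
        (fun c => ∃ v ∈ PQ.1, ∃ w ∈ PQ.2, (gr c).Adj v w), t c ≠ 0) ≤
      Real.exp (-((p * d) * a ^ 2 / (k ^ 3 * n))) := by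
    rintro ⟨P, Q⟩ hPQ
    obtain ⟨-, hP, hQ, hdisj⟩ := Finset.mem_filter.1 hPQ
    rw [labelProb_no_early]
    set M := Finset.univ.filter (fun c => ∃ v ∈ P, ∃ w ∈ Q, (gr c).Adj v w) with hM
    have hcount : P.card * Q.card * d ≤ k * n * (M.card * k ^ 2) := by
      have h1 : ∑ x ∈ P ×ˢ Q, d ≤
          ∑ x ∈ P ×ˢ Q, k * n * (M.filter (fun c => (gr c).Adj x.1 x.2)).card := by
        refine Finset.sum_le_sum fun x hx => ?_
        rw [Finset.mem_product] at hx
        have hne : x.1 ≠ x.2 := fun he => Finset.disjoint_left.1 hdisj hx.1 (he ▸ hx.2)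
        refine (h.le_card_adj _ _ hne).trans (Nat.mul_le_mul_left _ (Finset.card_le_card ?_))
        intro c hc
        rw [Finset.mem_filter] at hc
        simp only [hM, Finset.mem_filter, Finset.mem_univ, true_and]
        exact ⟨⟨x.1, hx.1, x.2, hx.2, hc.2⟩, hc.2⟩
      rw [Finset.sum_const, Finset.card_product, smul_eq_mul, ← Finset.mul_sum] at h1
      refine h1.trans (Nat.mul_le_mul_left _ ?_)
      have h2 : ∑ x ∈ P ×ˢ Q, (M.filter (fun c => (gr c).Adj x.1 x.2)).card =
          ∑ c ∈ M, ((P ×ˢ Q).filter (fun x => (gr c).Adj x.1 x.2)).card :=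
        Finset.sum_card_bipartiteAbove_eq_sum_card_bipartiteBelow _
      rw [h2, ← smul_eq_mul]
      refine Finset.sum_le_card_nsmul _ _ _ fun c _ => ?_
      have h3 : (P ×ˢ Q).filter (fun x => (gr c).Adj x.1 x.2) ⊆ suppF gr c ×ˢ suppF gr c := by
        intro x hx
        have hadj := (Finset.mem_filter.1 hx).2
        exact Finset.mem_product.2 ⟨mem_suppF.2 ⟨_, hadj⟩, mem_suppF.2 ⟨_, hadj.symm⟩⟩
      refine (Finset.card_le_card h3).trans ?_
      rw [Finset.card_product, sq]
      exact Nat.mul_le_mul (h.card_suppF_le c) (h.card_suppF_le c)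
    have h4 := one_add_pow_le_exp (x := -p) (by linarith) M.card
    refine h4.trans (Real.exp_le_exp.2 ?_)
    have h5 : (a : ℝ) ^ 2 * d / (k ^ 3 * n) ≤ M.card := by
      rw [div_le_iff₀ (by positivity)]
      have h6 : (a ^ 2 * d : ℕ) ≤ M.card * (k ^ 3 * n) := by
        have : a ^ 2 * d ≤ P.card * Q.card * d := by
          rw [sq]; exact Nat.mul_le_mul_right _ (Nat.mul_le_mul hP hQ)
        calc a ^ 2 * d ≤ _ := this.trans hcount
          _ = _ := by ring
      exact_mod_cast h6
    have h7 := mul_le_mul_of_nonneg_left h5 hp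
    have h8 : p * d * a ^ 2 / (k ^ 3 * n) = p * ((a : ℝ) ^ 2 * d / (k ^ 3 * n)) := by ring
    rw [h8]
    linarith
  refine (Finset.sum_le_card_nsmul _ _ _ hbound).trans ?_
  rw [nsmul_eq_mul]
  refine mul_le_mul_of_nonneg_right ?_ (Real.exp_nonneg _)
  have h9 := Finset.card_filter_le (Finset.univ ×ˢ Finset.univ :
        Finset (Finset (Fin n) × Finset (Fin n)))
          (fun PQ => a ≤ PQ.1.card ∧ a ≤ PQ.2.card ∧ Disjoint PQ.1 PQ.2)
  rw [Finset.card_product, Finset.card_univ, Fintype.card_finset, Fintype.card_fin,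
    ← mul_pow] at h9
  exact_mod_cast h9

end Events

section LocalEvents
open scoped Classical

variable {C : Type*} [Fintype C] {n : ℕ} {gr : C → SimpleGraph (Fin n)} {k d : ℕ}

/-- The members that contain two vertices of `W`. -/
noncomputable def spanning (gr : C → SimpleGraph (Fin n)) (W : Finset (Fin n)) : Finset C :=
  Finset.univ.filter
    (fun c => ∃ v ∈ W, ∃ w ∈ W, v ≠ w ∧ v ∈ (gr c).support ∧ w ∈ (gr c).support)

lemma IsRegularSystem.card_spanning_le (h : IsRegularSystem gr k d) (hn : 0 < n)
    (W : Finset (Fin n)) :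
    ((spanning gr W).card : ℝ) ≤ W.card ^ 2 * (2 * k * d / n) := by
  have h1 : spanning gr W ⊆ W.offDiag.biUnion (fun x => through gr x.1 ∩ through gr x.2) := by
    intro c hc
    obtain ⟨v, hv, w, hw, hvw, h1, h2⟩ := (Finset.mem_filter.1 hc).2
    exact Finset.mem_biUnion.2 ⟨(v, w), Finset.mem_offDiag.2 ⟨hv, hw, hvw⟩,
      Finset.mem_inter.2 ⟨mem_through.2 h1, mem_through.2 h2⟩⟩
  calc ((spanning gr W).card : ℝ)
      ≤ ∑ x ∈ W.offDiag, ((through gr x.1 ∩ through gr x.2).card : ℝ) := by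
        exact_mod_cast (Finset.card_le_card h1).trans Finset.card_biUnion_le
    _ ≤ ∑ x ∈ W.offDiag, (2 * k * d / n : ℝ) :=
        Finset.sum_le_sum fun x hx => h.codeg_le hn (Finset.mem_offDiag.1 hx).2.2
    _ = W.offDiag.card * (2 * k * d / n : ℝ) := by rw [Finset.sum_const, nsmul_eq_mul]
    _ ≤ _ := by
        refine mul_le_mul_of_nonneg_right ?_ (by positivity)
        have h2 : W.offDiag.card ≤ W.card ^ 2 := by
          rw [Finset.offDiag_card, sq]; exact Nat.sub_le _ _
        exact_mod_cast h2

/-- Some small set is spanned by many early members. -/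
lemma IsRegularSystem.labelProb_dense_le (h : IsRegularSystem gr k d) {p q : ℝ}
    (hp : 0 ≤ p) (hpq : p ≤ q) (hq : q ≤ 1) (hn : 0 < n) {m : ℕ} {s x L : ℝ}
    (hs : 0 ≤ s) (hx : 3 * L ≤ s * x) (hm : Real.exp s * (p * d) * (2 * k) * m / n ≤ L) :
    labelProb (phaseWeight p q) (fun t => ∃ W ∈ (Finset.univ : Finset (Finset (Fin n))).filter
        (fun W => W.Nonempty ∧ W.card ≤ m),
        x * W.card ≤ ((spanning gr W).filter (fun c => t c = 0)).card) ≤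
      (1 + Real.exp (-(2 * L))) ^ n - 1 := by
  refine (labelProb_exists_le (phaseWeight_nonneg hp hpq hq) _ _).trans ?_
  have hn' : (0 : ℝ) < n := by exact_mod_cast hn
  have hbound : ∀ W ∈ (Finset.univ : Finset (Finset (Fin n))).filter
      (fun W => W.Nonempty ∧ W.card ≤ m),
      labelProb (phaseWeight p q) (fun t : C → Fin 3 =>
        x * W.card ≤ ((spanning gr W).filter (fun c => t c = 0)).card) ≤
      Real.exp (-(2 * L)) ^ W.card := by
    intro W hW
    obtain ⟨-, -, hWm⟩ := Finset.mem_filter.1 hW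
    refine (labelProb_many_early_le hp hpq hq _ _ s hs).trans ?_
    rw [← Real.exp_nat_mul]
    refine Real.exp_le_exp.2 ?_
    have h1 : Real.exp s * p * (spanning gr W).card ≤ L * W.card := by
      calc Real.exp s * p * (spanning gr W).card
          ≤ Real.exp s * p * (W.card ^ 2 * (2 * k * d / n)) :=
            mul_le_mul_of_nonneg_left (h.card_spanning_le hn W) (by positivity)
        _ = (Real.exp s * (p * d) * (2 * k) / n * W.card) * W.card := by ring
        _ ≤ (Real.exp s * (p * d) * (2 * k) / n * m) * W.card := by
            have : (W.card : ℝ) ≤ m := by exact_mod_cast hWm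
            gcongr
        _ ≤ L * W.card := by
            refine mul_le_mul_of_nonneg_right ?_ (Nat.cast_nonneg _)
            rwa [div_mul_eq_mul_div]
    have h2 := mul_le_mul_of_nonneg_right hx (Nat.cast_nonneg (α := ℝ) W.card)
    linarith
  refine (Finset.sum_le_sum hbound).trans ?_
  have h3 : ∑ W : Finset (Fin n), Real.exp (-(2 * L)) ^ W.card =
      (1 + Real.exp (-(2 * L))) ^ n := by
    have := Fintype.sum_pow_mul_eq_add_pow (Fin n) (Real.exp (-(2 * L))) 1
    simpa [add_comm] using this
  rw [← h3, le_sub_iff_add_le, ← Finset.sum_filter_add_sum_filter_not Finset.univ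
    (fun W : Finset (Fin n) => W.Nonempty ∧ W.card ≤ m)]
  refine add_le_add le_rfl ?_
  refine le_trans ?_ (Finset.single_le_sum (f := fun W : Finset (Fin n) =>
    Real.exp (-(2 * L)) ^ W.card) (fun W _ => pow_nonneg (Real.exp_nonneg _) _)
    (a := ∅) (by simp))
  simp

/-- Two vertices of small early degree are close to each other. -/
lemma IsRegularSystem.labelProb_close_le (h : IsRegularSystem gr k d) {p q : ℝ}
    (hp : 0 ≤ p) (hpq : p ≤ q) (hq : q ≤ 1) (hn : 0 < n) (x : ℝ) :
    labelProb (phaseWeight p q) (fun t => ∃ v ∈ (Finset.univ : Finset (Fin n)),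
        ∃ i ∈ Finset.range 5, ∃ K ∈ explored gr v i, ∃ w ∈ (cluster gr v K).erase v,
        (∀ c ∈ K, t c ≤ 1) ∧
        ((((through gr v ∪ through gr w) \ K).filter (fun c => t c = 0)).card : ℝ) ≤ x) ≤
      n * ∑ i ∈ Finset.range 5, (((4 * k + 1) * (q * d)) ^ i * ((4 * k + 1) *
        Real.exp (2 * x - 3 / 4 * (2 * (p * d) - 2 * k * (p * d) / n - 4 * p)))) := by
  have hw := phaseWeight_nonneg hp hpq hq
  have hq0 : 0 ≤ q := hp.trans hpq
  set B := Real.exp (2 * x - 3 / 4 * (2 * (p * d) - 2 * k * (p * d) / n - 4 * p)) with hB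
  have hB0 : 0 ≤ B := Real.exp_nonneg _
  refine (labelProb_exists_le hw _ _).trans ?_
  refine (Finset.sum_le_card_nsmul _ _ _ fun v _ => ?_).trans_eq
    (by rw [Finset.card_univ, Fintype.card_fin, nsmul_eq_mul])
  refine (labelProb_exists_le hw _ _).trans (Finset.sum_le_sum fun i hi => ?_)
  have hi4 : i ≤ 4 := Nat.le_of_lt_succ (Finset.mem_range.1 hi)
  have hK : ∀ K ∈ explored gr v i, labelProb (phaseWeight p q) (fun t : C → Fin 3 =>
      ∃ w ∈ (cluster gr v K).erase v, (∀ c ∈ K, t c ≤ 1) ∧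
        ((((through gr v ∪ through gr w) \ K).filter (fun c => t c = 0)).card : ℝ) ≤ x) ≤
      (4 * k + 1) * (q ^ i * B) := by
    intro K hK
    have hKi := card_of_mem_explored hK
    refine (labelProb_exists_le hw _ _).trans ?_
    refine (Finset.sum_le_card_nsmul _ _ (q ^ i * B) fun w hwv => ?_).trans ?_
    · refine (labelProb_few_early_le hp hpq hq K _ Finset.disjoint_sdiff x 2
        (by norm_num)).trans ?_
      rw [hKi]
      refine mul_le_mul_of_nonneg_left (Real.exp_le_exp.2 ?_) (pow_nonneg hq0 _)
      have h1 : Real.exp (-2) ≤ 1 / 4 := by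
        have h2 : Real.exp (-2) = Real.exp (-1) * Real.exp (-1) := by
          rw [← Real.exp_add]; norm_num
        have h3 : Real.exp (-1) ≤ 1 / 2 := by
          have h4 := Real.add_one_le_exp (1 : ℝ)
          rw [Real.exp_neg, inv_le_comm₀ (Real.exp_pos _) (by norm_num)]
          linarith
        rw [h2]
        nlinarith [Real.exp_pos (-1)]
      have h2 : (2 * d - 2 * k * d / n - 4 : ℝ) ≤ ((through gr v ∪ through gr w) \ K).card := by
        have h3 := h.card_union_add v w
        have h4 := h.codeg_le hn (Finset.ne_of_mem_erase hwv).symm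
        have h5 : ((through gr v ∪ through gr w).card : ℝ) ≤
            ((through gr v ∪ through gr w) \ K).card + 4 := by
          have := Finset.card_le_card_sdiff_add_card
            (s := through gr v ∪ through gr w) (t := K)
          have h6 : (through gr v ∪ through gr w).card ≤
              ((through gr v ∪ through gr w) \ K).card + 4 := by omega
          exact_mod_cast h6
        linarith
      have h3 : p * (2 * d - 2 * k * d / n - 4 : ℝ) ≤
          p * ((through gr v ∪ through gr w) \ K).card := mul_le_mul_of_nonneg_left h2 hp
      have h4 : p * (2 * d - 2 * k * d / n - 4 : ℝ) =
          2 * (p * d) - 2 * k * (p * d) / n - 4 * p := by ring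
      have h5 : 3 / 4 * (p * ((through gr v ∪ through gr w) \ K).card) ≤
          (1 - Real.exp (-2)) * (p * ((through gr v ∪ through gr w) \ K).card) :=
        mul_le_mul_of_nonneg_right (by linarith) (by positivity)
      linarith
    · rw [nsmul_eq_mul]
      refine mul_le_mul_of_nonneg_right ?_ (by positivity)
      have h1 := (Finset.card_erase_le (a := v)).trans (card_cluster_le h.card_suppF_le v K)
      rw [hKi] at h1
      have h2 : ((cluster gr v K).erase v).card ≤ 4 * k + 1 :=
        h1.trans (Nat.succ_le_succ (Nat.mul_le_mul_right _ hi4))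
      exact_mod_cast h2
  refine (labelProb_exists_le hw _ _).trans ((Finset.sum_le_card_nsmul _ _ _ hK).trans ?_)
  rw [nsmul_eq_mul]
  have h1 : ((explored gr v i).card : ℝ) ≤ ((4 * k + 1) * d) ^ i := by
    exact_mod_cast card_explored_le h.card_suppF_le (fun v => (h.card_through v).le) v i 4 hi4
  calc ((explored gr v i).card : ℝ) * ((4 * k + 1) * (q ^ i * B))
      ≤ ((4 * k + 1) * d) ^ i * ((4 * k + 1) * (q ^ i * B)) :=
        mul_le_mul_of_nonneg_right h1 (by positivity)
    _ = _ := by rw [mul_pow, mul_pow, mul_pow]; ring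

end LocalEvents

section Combination
open scoped Classical

variable {C : Type*} [Fintype C] {n : ℕ} {gr : C → SimpleGraph (Fin n)} {k d : ℕ}

/-- The early members do not cover all vertices, the members that are not late do, and any
family in between without isolated vertices has a perfect matching. -/
def IsGood (gr : C → SimpleGraph (Fin n)) (t : C → Fin 3) : Prop :=
  (¬ ∀ v, ∃ w, (unionGraph gr (early t)).Adj v w) ∧
  (∀ v, ∃ w, (unionGraph gr (notLate t)).Adj v w) ∧
  ∀ E, early t ⊆ E → E ⊆ notLate t → (∀ v, ∃ w, (unionGraph gr E).Adj v w) →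
    ∃ M : (unionGraph gr E).Subgraph, M.IsPerfectMatching

lemma exists_unionGraph_adj {E : Finset C} {v : Fin n} :
    (∃ w, (unionGraph gr E).Adj v w) ↔ ∃ c ∈ E, c ∈ through gr v := by
  simp only [unionGraph_adj, mem_through, SimpleGraph.mem_support]
  exact ⟨fun ⟨w, c, hc, h⟩ => ⟨c, hc, w, h⟩, fun ⟨c, hc, w, h⟩ => ⟨w, c, hc, h⟩⟩

lemma IsRegularSystem.isGood (h : IsRegularSystem gr k d) (hk : 0 < k) (hn : Even n) {a : ℕ}
    (ha : 1 ≤ a) (ha2 : 2 * a ≤ n) {θ : ℝ} (hθ : 0 ≤ θ) {t : C → Fin 3}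
    (hiso : ¬ ∃ v ∈ Finset.univ, ∀ c ∈ through gr v, ¬ t c ≤ 1)
    (hcov : ¬ ∀ v, ¬ ∀ c ∈ through gr v, t c ≠ 0)
    (hjoin : ¬ ∃ PQ ∈ (Finset.univ ×ˢ Finset.univ :
        Finset (Finset (Fin n) × Finset (Fin n))).filter
          (fun PQ => a ≤ PQ.1.card ∧ a ≤ PQ.2.card ∧ Disjoint PQ.1 PQ.2),
        ∀ c ∈ Finset.univ.filter (fun c => ∃ v ∈ PQ.1, ∃ w ∈ PQ.2, (gr c).Adj v w), t c ≠ 0)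
    (hdense : ¬ ∃ W ∈ (Finset.univ : Finset (Finset (Fin n))).filter
        (fun W => W.Nonempty ∧ W.card ≤ 4 * a),
        θ / (4 * k) * W.card ≤ ((spanning gr W).filter (fun c => t c = 0)).card)
    (hclose : ¬ ∃ v ∈ (Finset.univ : Finset (Fin n)),
        ∃ i ∈ Finset.range 5, ∃ K ∈ explored gr v i, ∃ w ∈ (cluster gr v K).erase v,
        (∀ c ∈ K, t c ≤ 1) ∧
        ((((through gr v ∪ through gr w) \ K).filter (fun c => t c = 0)).card : ℝ) ≤ 2 * θ) :
    IsGood gr t := by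
  have hk' : (0 : ℝ) < 4 * k := by positivity
  refine ⟨fun hall => hcov fun v hv => ?_, fun v => ?_, fun E hE1 hE2 hdeg => ?_⟩
  · obtain ⟨c, hc, hcv⟩ := exists_unionGraph_adj.1 (hall v)
    exact hv c hcv (Finset.mem_filter.1 hc).2
  · push Not at hiso
    obtain ⟨c, hcv, hc⟩ := hiso v (Finset.mem_univ v)
    exact exists_unionGraph_adj.2 ⟨c, Finset.mem_filter.2 ⟨Finset.mem_univ c, hc⟩, hcv⟩
  · refine exists_isPerfectMatching gr (by simpa using hn) (early t) E hE1 k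
      (fun c => h.card_suppF_le c) hdeg a ha (by simpa using ha2) ?_ θ hθ ?_
      (Finset.univ.filter (fun v => (((early t).filter (fun c => v ∈ (gr c).support)).card : ℝ)
        < θ)) ?_ ?_
    · intro P Q hP hQ hPQ
      by_contra hno
      refine hjoin ⟨(P, Q), by simp [hP, hQ, hPQ], fun c hc h0 => hno ?_⟩
      exact ⟨c, Finset.mem_filter.2 ⟨Finset.mem_univ c, h0⟩, (Finset.mem_filter.1 hc).2⟩
    · intro W hW hWa
      by_contra hno
      rw [not_lt] at hno
      refine hdense ⟨W, Finset.mem_filter.2 ⟨Finset.mem_univ W, hW, hWa⟩, ?_⟩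
      rw [div_mul_eq_mul_div, div_le_iff₀ hk', mul_comm _ (4 * (k : ℝ))]
      convert hno using 4
      ext c
      simp [spanning, early, and_comm]
    · intro v hv
      simpa using hv
    · intro v hv w hw p hp
      by_contra hvw
      obtain ⟨j, hj, K, hK, hKE, hwK⟩ := exists_mem_explored p.reverse
      rw [SimpleGraph.Walk.length_reverse] at hj
      refine hclose ⟨v, Finset.mem_univ v, j, Finset.mem_range.2 (by omega), K, hK, w,
        Finset.mem_erase.2 ⟨Ne.symm hvw, hwK⟩,
        fun c hc => (Finset.mem_filter.1 (hE2 (hKE hc))).2, ?_⟩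
      have hv' := (Finset.mem_filter.1 hv).2
      have hw' := (Finset.mem_filter.1 hw).2
      have hsub : ((through gr v ∪ through gr w) \ K).filter (fun c => t c = 0) ⊆
          (early t).filter (fun c => v ∈ (gr c).support) ∪
            (early t).filter (fun c => w ∈ (gr c).support) := by
        intro c hc
        simp only [Finset.mem_filter, Finset.mem_sdiff, Finset.mem_union, mem_through, early,
          Finset.mem_univ, true_and] at hc ⊢
        tauto
      have hcard : ((((through gr v ∪ through gr w) \ K).filter (fun c => t c = 0)).card : ℝ) ≤
          ((early t).filter (fun c => v ∈ (gr c).support)).card +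
            ((early t).filter (fun c => w ∈ (gr c).support)).card := by
        exact_mod_cast (Finset.card_le_card hsub).trans (Finset.card_union_le _ _)
      linarith

/-- Upper bound for the probability that the labelling is not good. -/
noncomputable def errorBound (k n a : ℕ) : ℝ :=
  let L := Real.log n
  n * Real.exp (-(2 * L)) +
  (Real.exp (20 / 19 * (9 / 10 * L)) / n + (Real.exp (4 * k * (9 / 10 * L) / n) - 1)) +
  4 ^ n * Real.exp (-((9 / 10 * L) * a ^ 2 / (k ^ 3 * n))) +
  ((1 + Real.exp (-(2 * L))) ^ n - 1) +
  n * ∑ i ∈ Finset.range 5, (((4 * k + 1) * (2 * L)) ^ i * ((4 * k + 1) *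
    Real.exp (2 * (2 * (L / 40)) -
      3 / 4 * (2 * (9 / 10 * L) - 2 * k * (9 / 10 * L) / n - 1 / 5))))

lemma IsRegularSystem.labelProb_not_isGood_le (h : IsRegularSystem gr k d) (hk : 0 < k)
    (hd : 0 < d) (hn0 : 0 < n) (hn : Even n) {a : ℕ} (ha : 1 ≤ a) (ha2 : 2 * a ≤ n)
    (hsmall : Real.exp (480 * k) * (8 * k) * a ≤ n) (hq : 2 * Real.log n / d ≤ 1)
    (hp : 9 / 10 * Real.log n / d ≤ 1 / 20) :
    labelProb (phaseWeight (9 / 10 * Real.log n / d) (2 * Real.log n / d))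
      (fun t => ¬ IsGood gr t) ≤ errorBound k n a := by
  set L := Real.log n with hL
  set p := 9 / 10 * L / d with hpdef
  set q := 2 * L / d with hqdef
  have hd' : (0 : ℝ) < d := by exact_mod_cast hd
  have hk' : (0 : ℝ) < k := by exact_mod_cast hk
  have hn' : (0 : ℝ) < n := by exact_mod_cast hn0
  have hL0 : 0 ≤ L := Real.log_natCast_nonneg n
  have hpd : p * d = 9 / 10 * L := div_mul_cancel₀ _ hd'.ne'
  have hqd : q * d = 2 * L := div_mul_cancel₀ _ hd'.ne'
  have hp0 : 0 ≤ p := by positivity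
  have hpq : p ≤ q := div_le_div_of_nonneg_right (by linarith) hd'.le
  have hw := phaseWeight_nonneg hp0 hpq hq
  have b1 := h.labelProb_isolated_le hp0 hpq hq
  have b2 := h.labelProb_covered_le hp0 hpq hq hp hn0
  have b3 := h.labelProb_not_joined_le hp0 hpq hq hn0 hk a
  have b4 := h.labelProb_dense_le hp0 hpq hq hn0 (m := 4 * a) (s := 480 * k)
    (x := L / 40 / (4 * k)) (L := L) (by positivity)
    (by apply le_of_eq; field_simp; ring) (by
      rw [hpd, div_le_iff₀ hn']
      push_cast
      have := mul_le_mul_of_nonneg_left hsmall hL0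
      have h0 : 0 ≤ Real.exp (480 * k) * (8 * k) * a := by positivity
      nlinarith [mul_nonneg hL0 h0])
  have b5 := h.labelProb_close_le hp0 hpq hq hn0 (2 * (L / 40))
  rw [hqd] at b1 b5
  rw [hpd] at b2 b3
  rw [hpd] at b5
  have b5' := b5.trans (mul_le_mul_of_nonneg_left (Finset.sum_le_sum fun i _ =>
    mul_le_mul_of_nonneg_left (mul_le_mul_of_nonneg_left (Real.exp_le_exp.2
      (show 2 * (2 * (L / 40)) - 3 / 4 * (2 * (9 / 10 * L) - 2 * k * (9 / 10 * L) / n - 4 * p) ≤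
        2 * (2 * (L / 40)) - 3 / 4 * (2 * (9 / 10 * L) - 2 * k * (9 / 10 * L) / n - 1 / 5) by
        linarith)) (by positivity)) (by positivity)) hn'.le)
  refine le_trans ?_ (add_le_add (add_le_add (add_le_add (add_le_add b1 b2) b3) b4) b5')
  refine le_trans ?_ ((labelProb_or_le hw _ _).trans (add_le_add
    ((labelProb_or_le hw _ _).trans (add_le_add ((labelProb_or_le hw _ _).trans (add_le_add
      (labelProb_or_le hw _ _) le_rfl)) le_rfl)) le_rfl))
  refine labelProb_mono hw fun t ht => ?_
  by_contra hno
  simp only [not_or] at hno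
  obtain ⟨⟨⟨⟨h1, h2⟩, h3⟩, h4⟩, h5⟩ := hno
  exact ht (h.isGood hk hn ha ha2 (by positivity) h1 h2 h3 h4 h5)

end Combination

section Asymptotics

lemma tendsto_log_natCast_div : Tendsto (fun n : ℕ => Real.log n / n) atTop (nhds 0) := by
  have h := Real.isLittleO_log_id_atTop.tendsto_div_nhds_zero
  exact h.comp tendsto_natCast_atTop_atTop

lemma tendsto_log_natCast : Tendsto (fun n : ℕ => Real.log n) atTop atTop :=
  Real.tendsto_log_atTop.comp tendsto_natCast_atTop_atTop

lemma tendsto_close_term (k : ℕ) (i : ℕ) :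
    Tendsto (fun n : ℕ => (n : ℝ) * (((4 * k + 1) * (2 * Real.log n)) ^ i * ((4 * k + 1) *
      Real.exp (2 * (2 * (Real.log n / 40)) - 3 / 4 * (2 * (9 / 10 * Real.log n) -
        2 * k * (9 / 10 * Real.log n) / n - 1 / 5))))) atTop (nhds 0) := by
  have h1 : Tendsto (fun n : ℕ => (Real.log n / 4) ^ i * Real.exp (-(Real.log n / 4)))
      atTop (nhds 0) :=
    (Real.tendsto_pow_mul_exp_neg_atTop_nhds_zero i).comp
      (tendsto_log_natCast.atTop_div_const (by norm_num))
  have h2 : Tendsto (fun n : ℕ => ((4 * k + 1) * 8 : ℝ) ^ i * (4 * k + 1) *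
      Real.exp (27 / 20 * k * (Real.log n / n) + 3 / 20)) atTop
      (nhds (((4 * k + 1) * 8 : ℝ) ^ i * (4 * k + 1) *
        Real.exp (27 / 20 * k * 0 + 3 / 20))) :=
    ((Real.continuous_exp.tendsto _).comp
      ((tendsto_log_natCast_div.const_mul _).add_const _)).const_mul _
  have h3 := h1.mul h2
  rw [zero_mul] at h3
  refine h3.congr' ?_
  filter_upwards [eventually_gt_atTop 0] with n hn
  have hn' : (0 : ℝ) < n := by exact_mod_cast hn
  set L := Real.log n with hL
  have hexp : Real.exp (2 * (2 * (L / 40)) - 3 / 4 * (2 * (9 / 10 * L) -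
      2 * k * (9 / 10 * L) / n - 1 / 5)) * n =
      Real.exp (-(L / 4)) * Real.exp (27 / 20 * k * (L / n) + 3 / 20) := by
    nth_rewrite 2 [← Real.exp_log hn']
    rw [← Real.exp_add, ← Real.exp_add, ← hL]
    congr 1
    ring
  calc (L / 4) ^ i * Real.exp (-(L / 4)) * (((4 * k + 1) * 8 : ℝ) ^ i * (4 * k + 1) *
      Real.exp (27 / 20 * k * (L / n) + 3 / 20))
      = ((L / 4) ^ i * ((4 * k + 1) * 8 : ℝ) ^ i) * (4 * k + 1) *
        (Real.exp (-(L / 4)) * Real.exp (27 / 20 * k * (L / n) + 3 / 20)) := by ring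
    _ = _ := by
        rw [← hexp, ← mul_pow, show L / 4 * ((4 * k + 1) * 8 : ℝ) = (4 * k + 1) * (2 * L) by ring]
        ring

lemma tendsto_joined_term {k : ℕ} (hk : 0 < k) {η : ℝ} (hη : 0 < η) :
    Tendsto (fun n : ℕ => (4 : ℝ) ^ n *
      Real.exp (-((9 / 10 * Real.log n) * (⌊η * n⌋₊ : ℝ) ^ 2 / (k ^ 3 * n)))) atTop (nhds 0) := by
  have hk' : (0 : ℝ) < k := by exact_mod_cast hk
  have hlim : Tendsto (fun n : ℕ => Real.exp (-(n : ℝ))) atTop (nhds 0) :=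
    Real.tendsto_exp_neg_atTop_nhds_zero.comp tendsto_natCast_atTop_atTop
  refine tendsto_of_tendsto_of_tendsto_of_le_of_le' tendsto_const_nhds hlim
    (Eventually.of_forall fun n => by positivity) ?_
  set c : ℝ := 9 / 10 * (η / 2) ^ 2 / k ^ 3 with hc
  have hc0 : 0 < c := by positivity
  have hlarge : ∀ᶠ n : ℕ in atTop, 2 ≤ η * n :=
    (tendsto_natCast_atTop_atTop.const_mul_atTop hη).eventually_ge_atTop 2
  filter_upwards [tendsto_log_natCast.eventually_ge_atTop ((Real.log 4 + 1) / c), hlarge,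
    eventually_gt_atTop 0] with n h1 h2 hn
  have hn' : (0 : ℝ) < n := by exact_mod_cast hn
  rw [div_le_iff₀ hc0] at h1
  have hL0 : 0 ≤ Real.log n := Real.log_natCast_nonneg n
  have hfloor : η / 2 * n ≤ ⌊η * n⌋₊ := by
    have := Nat.lt_floor_add_one (η * n)
    linarith
  have h4 : (4 : ℝ) ^ n = Real.exp (n * Real.log 4) := by
    rw [Real.exp_nat_mul, Real.exp_log (by norm_num)]
  rw [h4, ← Real.exp_add]
  refine Real.exp_le_exp.2 ?_
  have h5 : Real.log n * c * n ≤ (9 / 10 * Real.log n) * (⌊η * n⌋₊ : ℝ) ^ 2 / (k ^ 3 * n) := by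
    rw [le_div_iff₀ (by positivity)]
    have h6 : (η / 2 * n) ^ 2 ≤ (⌊η * n⌋₊ : ℝ) ^ 2 :=
      pow_le_pow_left₀ (by positivity) hfloor 2
    calc Real.log n * c * n * (k ^ 3 * n) = 9 / 10 * Real.log n * (η / 2 * n) ^ 2 := by
          rw [hc]; field_simp
      _ ≤ _ := mul_le_mul_of_nonneg_left h6 (by positivity)
  nlinarith [mul_le_mul_of_nonneg_right h1 hn'.le]

lemma tendsto_errorBound {k : ℕ} (hk : 0 < k) {η : ℝ} (hη : 0 < η) :
    Tendsto (fun n : ℕ => errorBound k n ⌊η * n⌋₊) atTop (nhds 0) := by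
  have hexp : ∀ n : ℕ, 0 < n → (n : ℝ) * Real.exp (-(2 * Real.log n)) = Real.exp (-Real.log n) := by
    intro n hn
    have hn' : (0 : ℝ) < n := by exact_mod_cast hn
    nth_rewrite 1 [← Real.exp_log hn']
    rw [← Real.exp_add]
    congr 1
    ring
  have h1 : Tendsto (fun n : ℕ => (n : ℝ) * Real.exp (-(2 * Real.log n))) atTop (nhds 0) := by
    refine (Real.tendsto_exp_neg_atTop_nhds_zero.comp tendsto_log_natCast).congr' ?_
    filter_upwards [eventually_gt_atTop 0] with n hn
    exact (hexp n hn).symm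
  have h2 : Tendsto (fun n : ℕ => Real.exp (20 / 19 * (9 / 10 * Real.log n)) / n)
      atTop (nhds 0) := by
    refine (Real.tendsto_exp_neg_atTop_nhds_zero.comp
      (tendsto_log_natCast.atTop_div_const (show (0 : ℝ) < 19 by norm_num))).congr' ?_
    filter_upwards [eventually_gt_atTop 0] with n hn
    have hn' : (0 : ℝ) < n := by exact_mod_cast hn
    rw [Function.comp_apply, eq_div_iff hn'.ne']
    nth_rewrite 2 [← Real.exp_log hn']
    rw [← Real.exp_add]
    congr 1
    ring
  have h3 : Tendsto (fun n : ℕ => Real.exp (4 * k * (9 / 10 * Real.log n) / n) - 1)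
      atTop (nhds 0) := by
    have := ((Real.continuous_exp.tendsto _).comp
      (tendsto_log_natCast_div.const_mul (18 / 5 * k : ℝ))).sub_const 1
    rw [mul_zero, Real.exp_zero, sub_self] at this
    refine this.congr fun n => ?_
    simp only [Function.comp_apply]
    congr 2
    ring
  have h4 : Tendsto (fun n : ℕ => (1 + Real.exp (-(2 * Real.log n))) ^ n - 1)
      atTop (nhds 0) := by
    have hup : Tendsto (fun n : ℕ => Real.exp ((n : ℝ) * Real.exp (-(2 * Real.log n))) - 1)
        atTop (nhds 0) := by
      have := ((Real.continuous_exp.tendsto _).comp h1).sub_const 1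
      rwa [Real.exp_zero, sub_self] at this
    refine tendsto_of_tendsto_of_tendsto_of_le_of_le tendsto_const_nhds hup (fun n => ?_)
      fun n => ?_
    · exact sub_nonneg.2 (one_le_pow₀ (le_add_of_nonneg_right (Real.exp_nonneg _)))
    · refine sub_le_sub_right ?_ 1
      rw [mul_comm (n : ℝ)]
      exact one_add_pow_le_exp (by linarith [Real.exp_pos (-(2 * Real.log n))]) n
  have h5 := tendsto_finsetSum (Finset.range 5) fun i _ => tendsto_close_term k i
  simp only [← Finset.mul_sum, Finset.sum_const_zero] at h5
  simpa only [errorBound, add_zero] using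
    (((h1.add (h2.add h3)).add (tendsto_joined_term hk hη)).add h4).add h5

end Asymptotics

section Symmetry
open scoped Classical

variable {C : Type*} [Fintype C] {n : ℕ} {gr : C → SimpleGraph (Fin n)} {k : ℕ}

/-- Every permutation of the vertices induces a permutation of the family. -/
def IsSymmetric (gr : C → SimpleGraph (Fin n)) : Prop :=
  ∀ σ : Equiv.Perm (Fin n), ∃ e : C ≃ C, ∀ c v w,
    (gr (e c)).Adj (σ v) (σ w) ↔ (gr c).Adj v w

lemma exists_perm_map_pair {v w v' w' : Fin n} (h : v ≠ w) (h' : v' ≠ w') :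
    ∃ σ : Equiv.Perm (Fin n), σ v = v' ∧ σ w = w' := by
  refine ⟨Equiv.swap (Equiv.swap v v' w) w' * Equiv.swap v v', ?_, ?_⟩
  · rw [Equiv.Perm.mul_apply, Equiv.swap_apply_left]
    refine Equiv.swap_apply_of_ne_of_ne (fun he => h ?_) h'
    exact (Equiv.swap v v').injective ((Equiv.swap_apply_left v v').trans he)
  · rw [Equiv.Perm.mul_apply, Equiv.swap_apply_left]

lemma mem_support_iff_of_adj_iff {σ : Equiv.Perm (Fin n)} {G G' : SimpleGraph (Fin n)}
    (h : ∀ v w, G'.Adj (σ v) (σ w) ↔ G.Adj v w) (v : Fin n) :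
    σ v ∈ G'.support ↔ v ∈ G.support := by
  simp only [SimpleGraph.mem_support]
  exact ⟨fun ⟨w, hw⟩ => ⟨σ.symm w, (h v _).1 (by simpa using hw)⟩,
    fun ⟨w, hw⟩ => ⟨σ w, (h v w).2 hw⟩⟩

lemma IsSymmetric.card_through_eq (h : IsSymmetric gr) (v v' : Fin n) :
    (through gr v).card = (through gr v').card := by
  obtain ⟨e, he⟩ := h (Equiv.swap v v')
  refine Finset.card_equiv e fun c => ?_
  rw [mem_through, mem_through]
  have := mem_support_iff_of_adj_iff (he c) v
  rw [Equiv.swap_apply_left] at this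
  exact this.symm

lemma IsSymmetric.card_through_inter_eq (h : IsSymmetric gr) {v w v' w' : Fin n} (hvw : v ≠ w)
    (hvw' : v' ≠ w') : (through gr v ∩ through gr w).card =
      (through gr v' ∩ through gr w').card := by
  obtain ⟨σ, rfl, rfl⟩ := exists_perm_map_pair hvw hvw'
  obtain ⟨e, he⟩ := h σ
  refine Finset.card_equiv e fun c => ?_
  simp only [Finset.mem_inter, mem_through, mem_support_iff_of_adj_iff (he c)]

lemma IsSymmetric.card_adj_eq (h : IsSymmetric gr) {v w v' w' : Fin n} (hvw : v ≠ w)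
    (hvw' : v' ≠ w') : (Finset.univ.filter (fun c => (gr c).Adj v w)).card =
      (Finset.univ.filter (fun c => (gr c).Adj v' w')).card := by
  obtain ⟨σ, rfl, rfl⟩ := exists_perm_map_pair hvw hvw'
  obtain ⟨e, he⟩ := h σ
  refine Finset.card_equiv e fun c => ?_
  simp [he]

lemma sum_card_through_le (hk : ∀ c, (suppF gr c).card ≤ k) (S : Finset C) :
    ∑ v, (S ∩ through gr v).card ≤ S.card * k := by
  have h1 : ∑ v : Fin n, (S.filter (fun c => v ∈ suppF gr c)).card =
      ∑ c ∈ S, (Finset.univ.filter (fun v => v ∈ suppF gr c)).card :=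
    Finset.sum_card_bipartiteAbove_eq_sum_card_bipartiteBelow _
  have h2 : ∀ v, S ∩ through gr v = S.filter (fun c => v ∈ suppF gr c) := by
    intro v
    ext c
    simp only [Finset.mem_inter, Finset.mem_filter, mem_through, mem_suppF]
  simp_rw [h2]
  rw [h1, ← smul_eq_mul]
  refine Finset.sum_le_card_nsmul _ _ _ fun c _ => ?_
  rw [Finset.filter_univ_mem]
  exact hk c

lemma IsSymmetric.isRegularSystem (h : IsSymmetric gr) (hk : ∀ c, (suppF gr c).card ≤ k)
    (hedge : ∀ c, ∃ v w, (gr c).Adj v w) (hn : 2 ≤ n) (v₀ : Fin n) :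
    IsRegularSystem gr k (through gr v₀).card where
  card_suppF_le := hk
  card_through v := h.card_through_eq v v₀
  card_through_inter v w hvw := by
    have h1 := sum_card_through_le hk (through gr v)
    have h2 : ∑ x ∈ Finset.univ.erase v, (through gr v ∩ through gr x).card =
        (n - 1) * (through gr v ∩ through gr w).card := by
      rw [Finset.sum_congr rfl fun x hx =>
        h.card_through_inter_eq (Finset.ne_of_mem_erase hx).symm hvw, Finset.sum_const,
        Finset.card_erase_of_mem (Finset.mem_univ v), Finset.card_univ, Fintype.card_fin,
        smul_eq_mul]
    have h3 : (n - 1) * (through gr v ∩ through gr w).card ≤ (through gr v).card * k := by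
      rw [← h2]
      exact (Finset.sum_le_sum_of_subset (Finset.erase_subset _ _)).trans h1
    rw [h.card_through_eq v v₀] at h3
    have h4 : n ≤ 2 * (n - 1) := by omega
    calc (through gr v ∩ through gr w).card * n
        ≤ (through gr v ∩ through gr w).card * (2 * (n - 1)) := Nat.mul_le_mul_left _ h4
      _ = 2 * ((n - 1) * (through gr v ∩ through gr w).card) := by ring
      _ ≤ 2 * ((through gr v₀).card * k) := Nat.mul_le_mul_left _ h3
      _ = _ := by ring
  le_card_adj v w hvw := by
    set M := (Finset.univ.filter (fun c => (gr c).Adj v w)).card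
    have h1 := sum_card_through_le hk (Finset.univ : Finset C)
    simp only [Finset.univ_inter] at h1
    rw [Finset.sum_congr rfl fun x _ => h.card_through_eq x v₀, Finset.sum_const,
      Finset.card_univ, Finset.card_univ, Fintype.card_fin, smul_eq_mul] at h1
    have h2 : Fintype.card C ≤ n * n * M := by
      have h3 : ∑ x : Fin n × Fin n,
          (Finset.univ.filter (fun c => (gr c).Adj x.1 x.2)).card =
          ∑ c : C, (Finset.univ.filter (fun x : Fin n × Fin n => (gr c).Adj x.1 x.2)).card :=
        Finset.sum_card_bipartiteAbove_eq_sum_card_bipartiteBelow _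
      calc Fintype.card C = ∑ _c : C, 1 := by simp
        _ ≤ ∑ c : C, (Finset.univ.filter (fun x : Fin n × Fin n => (gr c).Adj x.1 x.2)).card := by
            refine Finset.sum_le_sum fun c _ => ?_
            obtain ⟨x, y, hxy⟩ := hedge c
            exact Finset.card_pos.2 ⟨(x, y), by simpa using hxy⟩
        _ ≤ ∑ _x : Fin n × Fin n, M := by
            rw [← h3]
            refine Finset.sum_le_sum fun x _ => ?_
            by_cases hx : x.1 = x.2
            · simp [hx]
            · exact (h.card_adj_eq hx hvw).le
        _ = _ := by simp
    refine Nat.le_of_mul_le_mul_left (c := n) ?_ (by omega)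
    calc n * (through gr v₀).card ≤ _ := h1
      _ ≤ n * n * M * k := Nat.mul_le_mul_right _ h2
      _ = _ := by ring

lemma IsRegularSystem.le_two_mul {d : ℕ} (h : IsRegularSystem gr k d)
    (hn : 2 ≤ n) (hd : 0 < d) : n ≤ 2 * k * d := by
  have hne : (⟨0, by omega⟩ : Fin n) ≠ ⟨1, by omega⟩ := by simp
  have h1 := h.le_card_adj _ _ hne
  have h2 := h.card_through_inter _ _ hne
  set v : Fin n := ⟨0, by omega⟩
  set w : Fin n := ⟨1, by omega⟩
  have h3 : 0 < (Finset.univ.filter (fun c => (gr c).Adj v w)).card := by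
    rw [Nat.pos_iff_ne_zero]
    intro h0
    rw [h0] at h1
    omega
  have h4 : (Finset.univ.filter (fun c => (gr c).Adj v w)).card ≤
      (through gr v ∩ through gr w).card := by
    refine Finset.card_le_card fun c hc => ?_
    have hadj := (Finset.mem_filter.1 hc).2
    exact Finset.mem_inter.2 ⟨mem_through.2 ⟨_, hadj⟩, mem_through.2 ⟨_, hadj.symm⟩⟩
  exact (Nat.le_mul_of_pos_left n (h3.trans_le h4)).trans h2

end Symmetry

section Copies
open scoped Classical

variable {k n : ℕ} {H : SimpleGraph (Fin k)}

lemma IsCopy.map_perm {G : SimpleGraph (Fin n)} (h : IsCopy H G) (σ : Equiv.Perm (Fin n)) :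
    IsCopy H (G.map σ) := by
  obtain ⟨f, rfl⟩ := h
  exact ⟨f.trans σ.toEmbedding, SimpleGraph.map_map _ _ _⟩

lemma isSymmetric_copy [Fintype (Copy H n)] : IsSymmetric (fun c : Copy H n => c.1) := by
  intro σ
  refine ⟨⟨fun c => ⟨c.1.map σ, c.2.map_perm σ⟩, fun c => ⟨c.1.map σ.symm, c.2.map_perm σ.symm⟩,
    fun c => ?_, fun c => ?_⟩, fun c v w => ?_⟩
  · exact Subtype.ext (by ext v w; simp)
  · exact Subtype.ext (by ext v w; simp)
  · exact SimpleGraph.map_adj_apply (f := σ.toEmbedding)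

lemma card_suppF_copy_le [Fintype (Copy H n)] (c : Copy H n) :
    (suppF (fun c : Copy H n => c.1) c).card ≤ k := by
  obtain ⟨f, hf⟩ := c.2
  have hsub : suppF (fun c : Copy H n => c.1) c ⊆ Finset.univ.map f := by
    intro v hv
    obtain ⟨w, hw⟩ := (SimpleGraph.mem_support _).1 (mem_suppF.1 hv)
    rw [hf, SimpleGraph.map_adj] at hw
    obtain ⟨x, y, -, rfl, -⟩ := hw
    simp
  simpa using Finset.card_le_card hsub

lemma exists_adj_copy (hk : 0 < k) (hiso : ∀ v, (H.neighborSet v).Nonempty) (c : Copy H n) :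
    ∃ v w, c.1.Adj v w := by
  obtain ⟨f, hf⟩ := c.2
  obtain ⟨y, hy⟩ := hiso ⟨0, hk⟩
  exact ⟨f ⟨0, hk⟩, f y, by rw [hf, SimpleGraph.map_adj]; exact ⟨_, _, hy, rfl, rfl⟩⟩

lemma exists_isRegularSystem_copy [Fintype (Copy H n)] (hk : 0 < k)
    (hiso : ∀ v, (H.neighborSet v).Nonempty) (hn : 2 ≤ n) (hkn : k ≤ n) :
    ∃ d, 0 < d ∧ IsRegularSystem (fun c : Copy H n => c.1) k d := by
  let c : Copy H n := ⟨H.map (Fin.castLEEmb hkn), Fin.castLEEmb hkn, rfl⟩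
  obtain ⟨v, w, h⟩ := exists_adj_copy hk hiso c
  refine ⟨_, Finset.card_pos.2 ⟨c, mem_through.2 h.mem_support_left⟩, isSymmetric_copy.isRegularSystem
    card_suppF_copy_le (exists_adj_copy hk hiso) hn v⟩

end Copies

open scoped Classical in
lemma one_sub_errorBound_le {k n a : ℕ} {H : SimpleGraph (Fin k)} (hk : 0 < k)
    (hiso : ∀ v, (H.neighborSet v).Nonempty) (hn2 : 2 ≤ n) (hkn : k ≤ n) (hn : Even n)
    (ha : 1 ≤ a) (ha2 : 2 * a ≤ n) (hsmall : Real.exp (480 * k) * (8 * k) * a ≤ n)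
    (hlog : 40 * k * Real.log n ≤ n) :
    1 - errorBound k n a ≤ procProb H n (fun ω => tauMatch ω = tauDeg 1 ω) := by
  let _ : Fintype (Copy H n) := Fintype.ofFinite _
  obtain ⟨d, hd, h⟩ := exists_isRegularSystem_copy (H := H) hk hiso hn2 hkn
  have hd' : (0 : ℝ) < d := by exact_mod_cast hd
  have hk' : (0 : ℝ) < k := by exact_mod_cast hk
  have hnd : (n : ℝ) ≤ 2 * k * d := by exact_mod_cast h.le_two_mul hn2 hd
  have hLd : 20 * Real.log n ≤ d := by
    refine le_of_mul_le_mul_left (a := 2 * (k : ℝ)) ?_ (by positivity)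
    linarith
  have hL0 : 0 ≤ Real.log n := Real.log_natCast_nonneg n
  have hq : 2 * Real.log n / d ≤ 1 := by
    rw [div_le_one hd']; linarith
  have hp : 9 / 10 * Real.log n / d ≤ 1 / 20 := by
    rw [div_le_iff₀ hd']; linarith
  have hbound := h.labelProb_not_isGood_le hk hd (by omega) hn ha ha2 hsmall hq hp
  have hpq : 9 / 10 * Real.log n / d ≤ 2 * Real.log n / d :=
    div_le_div_of_nonneg_right (by linarith) hd'.le
  have htransfer := one_sub_labelProb_le (C := Copy H n) (N := numCopies H n)
    (Nat.card_eq_fintype_card (α := Copy H n)).symm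
    (phaseWeight_nonneg (by positivity) hpq hq) (sum_phaseWeight _ _)
    (fun ω => tauMatch ω = tauDeg 1 ω) (fun t => ¬ IsGood (fun c : Copy H n => c.1) t)
    (fun ω u hu hgood => by
      obtain ⟨h1, h2, h3⟩ := not_not.1 hgood
      exact tauMatch_eq_tauDeg_one ω u hu h1 h2 h3)
  exact (sub_le_sub_left hbound 1).trans htransfer

lemma procProb_le_one {k n : ℕ} (H : SimpleGraph (Fin k)) (P : ProcSample H n → Prop) :
    procProb H n P ≤ 1 :=
  div_le_one_of_le₀ (by exact_mod_cast Finite.card_subtype_le P) (Nat.cast_nonneg _)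

/-- **Theorem 5 (hitting time of perfect matchings).**  For even `n` (we let
`n = 2m`, `m → ∞`), w.h.p. the random motif graph process acquires a perfect
matching exactly when the minimum degree becomes `1`: `τ_M = τ_1`. -/
theorem hitting_time_perfect_matching {k : ℕ} (H : SimpleGraph (Fin k)) (hk : 0 < k)
    (hiso : ∀ v, (H.neighborSet v).Nonempty) :
    Tendsto (fun m => procProb H (2 * m) (fun ω => tauMatch ω = tauDeg 1 ω))
      atTop (nhds 1) := by
  have hk' : (0 : ℝ) < k := by exact_mod_cast hk
  set B : ℝ := Real.exp (480 * k) * (8 * k) with hB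
  have hB0 : 0 < B := by positivity
  have hB2 : 2 ≤ B := by
    have h1 : 1 ≤ Real.exp (480 * k) := Real.one_le_exp (by positivity)
    have h2 : (1 : ℝ) ≤ k := by exact_mod_cast hk
    nlinarith
  have hdouble : Tendsto (fun m : ℕ => 2 * m) atTop atTop :=
    tendsto_id.const_mul_atTop' (by norm_num)
  have hlow : Tendsto (fun m : ℕ => 1 - errorBound k (2 * m) ⌊B⁻¹ * (2 * m : ℕ)⌋₊) atTop
      (nhds 1) := by
    simpa using ((tendsto_errorBound hk (inv_pos.2 hB0)).comp hdouble).const_sub 1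
  refine tendsto_of_tendsto_of_tendsto_of_le_of_le' hlow tendsto_const_nhds ?_
    (Eventually.of_forall fun m => procProb_le_one H _)
  have hlog : ∀ᶠ n : ℕ in atTop, 40 * k * Real.log n ≤ (n : ℝ) := by
    filter_upwards [tendsto_log_natCast_div.eventually_le_const
      (show (0 : ℝ) < (40 * (k : ℝ))⁻¹ by positivity), eventually_gt_atTop 0] with n h1 h2
    rw [div_le_iff₀ (by exact_mod_cast h2), inv_mul_eq_div, le_div_iff₀ (by positivity)] at h1
    linarith
  have hfloor : ∀ᶠ n : ℕ in atTop, 1 ≤ B⁻¹ * (n : ℝ) :=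
    (tendsto_natCast_atTop_atTop.const_mul_atTop (inv_pos.2 hB0)).eventually_ge_atTop 1
  filter_upwards [hdouble.eventually hlog, hdouble.eventually hfloor,
    hdouble.eventually_ge_atTop 2, hdouble.eventually_ge_atTop k] with m h1 h2 h3 h4
  have hfl : B * (⌊B⁻¹ * (2 * m : ℕ)⌋₊ : ℝ) ≤ (2 * m : ℕ) := by
    have := Nat.floor_le (zero_le_one.trans h2)
    calc B * (⌊B⁻¹ * (2 * m : ℕ)⌋₊ : ℝ) ≤ B * (B⁻¹ * (2 * m : ℕ)) :=
          mul_le_mul_of_nonneg_left this hB0.le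
      _ = _ := by rw [mul_inv_cancel_left₀ hB0.ne']
  refine one_sub_errorBound_le hk hiso h3 h4 (even_two_mul m) (Nat.floor_pos.2 h2) ?_ hfl h1
  have h5 : (2 : ℝ) * (⌊B⁻¹ * (2 * m : ℕ)⌋₊ : ℝ) ≤ (2 * m : ℕ) :=
    (mul_le_mul_of_nonneg_right hB2 (Nat.cast_nonneg _)).trans hfl
  exact_mod_cast h5

end RandomMotif
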